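/- arXiv:1303.1998 — 2 statements merged into one kernel-verified Lean document; each statement's English description precedes it below -/
import Mathlib

section
/- Let q be a prime power and f ∈ F_q[t][x] with deg_x f ≥ 1 which is separable as a polynomial in x over F_q(t) and absolutely irreducible (irreducible as a polynomial in the two variables t, x over an algebraic closure of F_q). Then the limit α(f) := lim_{b_0 → ∞} Σ_{ℓ monic irreducible, deg ℓ ≤ b_0} α_ℓ(f) exists. -/
open Polynomial Filter

/-- The homogenization `F(a,b)` of `f ∈ F_q[t][x]` evaluated at polynomials `a, b`. -/
noncomputable def homogEval {Fq : Type*} [Field Fq] (f : Polynomial (Polynomial Fq))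
    (a b : Polynomial Fq) : Polynomial Fq :=
  ∑ i ∈ Finset.range (f.natDegree + 1), f.coeff i * a ^ i * b ^ (f.natDegree - i)

section CoordinateDegree

variable {k R ι : Type*} [Field k] [CommRing R] [Algebra k[X] R]

/-- All coordinates of `u` in the `k[X]`-basis `b` have degree at most `w`. -/
def CoordDegreeLE (b : Module.Basis ι k[X] R) (w : ℕ) (u : R) : Prop :=
  ∀ i, (b.repr u i).natDegree ≤ w

lemma CoordDegreeLE.mono {b : Module.Basis ι k[X] R} {w w' : ℕ} (h : w ≤ w') {u : R}
    (hu : CoordDegreeLE b w u) : CoordDegreeLE b w' u := fun i => (hu i).trans h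

lemma CoordDegreeLE.sum {b : Module.Basis ι k[X] R} {w : ℕ} {κ : Type*} (s : Finset κ)
    (u : κ → R) (hu : ∀ j ∈ s, CoordDegreeLE b w (u j)) : CoordDegreeLE b w (∑ j ∈ s, u j) := by
  intro i
  rw [map_sum, Finsupp.finsetSum_apply]
  exact natDegree_sum_le_of_forall_le _ _ fun j hj => hu j hj i

lemma CoordDegreeLE.smul {b : Module.Basis ι k[X] R} {w v : ℕ} {p : k[X]} (hp : p.natDegree ≤ v)
    {u : R} (hu : CoordDegreeLE b w u) : CoordDegreeLE b (w + v) (p • u) := by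
  intro i
  rw [map_smul, Finsupp.smul_apply, smul_eq_mul, add_comm]
  exact natDegree_mul_le_of_le hp (hu i)

variable [Fintype ι]

lemma exists_coordDegreeLE (b : Module.Basis ι k[X] R) (u : R) : ∃ w, CoordDegreeLE b w u :=
  ⟨∑ i, (b.repr u i).natDegree, fun i =>
    Finset.single_le_sum (f := fun i => (b.repr u i).natDegree) (fun _ _ => Nat.zero_le _)
      (Finset.mem_univ i)⟩

lemma exists_coordDegreeLE_mul (b : Module.Basis ι k[X] R) (y : R) :
    ∃ c, ∀ w u, CoordDegreeLE b w u → CoordDegreeLE b (w + c) (y * u) := by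
  choose e he using fun i => exists_coordDegreeLE b (y * b i)
  refine ⟨∑ i, e i, fun w u hu => ?_⟩
  rw [← b.sum_repr u, Finset.mul_sum]
  refine CoordDegreeLE.sum _ _ fun i _ => ?_
  rw [mul_smul_comm, add_comm]
  refine CoordDegreeLE.smul (hu i) ((he i).mono ?_)
  exact Finset.single_le_sum (f := e) (fun _ _ => Nat.zero_le _) (Finset.mem_univ i)

lemma exists_coordDegreeLE_pow_mul (b : Module.Basis ι k[X] R) (y : R) :
    ∃ c, ∀ n w u, CoordDegreeLE b w u → CoordDegreeLE b (w + c * n) (y ^ n * u) := by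
  obtain ⟨c, hc⟩ := exists_coordDegreeLE_mul b y
  refine ⟨c, fun n => ?_⟩
  induction n with
  | zero => intro w u hu; simpa using hu
  | succ n ih =>
    intro w u hu
    rw [pow_succ', mul_assoc, mul_add, mul_one, ← add_assoc]
    exact hc _ _ (ih _ _ hu)

lemma exists_coordDegreeLE_smul_pow_mul_pow (b : Module.Basis ι k[X] R) (x z : R) :
    ∃ c, ∀ α β γ, CoordDegreeLE b (α + c * (β + γ + 1)) ((X ^ α : k[X]) • (x ^ β * z ^ γ)) := by
  obtain ⟨c₀, h₀⟩ := exists_coordDegreeLE b 1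
  obtain ⟨c₁, h₁⟩ := exists_coordDegreeLE_pow_mul b x
  obtain ⟨c₂, h₂⟩ := exists_coordDegreeLE_pow_mul b z
  refine ⟨c₀ + c₁ + c₂, fun α β γ => ?_⟩
  have h := (h₁ β _ _ (h₂ γ _ _ h₀)).smul (p := X ^ α) (v := α) (natDegree_X_pow_le α)
  rw [mul_one] at h
  refine h.mono ?_
  nlinarith [Nat.zero_le (c₀ * β), Nat.zero_le (c₀ * γ), Nat.zero_le (c₁ * γ),
    Nat.zero_le (c₂ * β)]

lemma exists_finrank_quotient_le [DecidableEq ι] [IsDomain R] [Algebra k R] [IsScalarTower k k[X] R]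
    (b : Module.Basis ι k[X] R) :
    ∃ C, ∀ w u, u ≠ 0 → CoordDegreeLE b w u →
      Module.finrank k (R ⧸ Ideal.span ({u} : Set R)) ≤ Fintype.card ι * (w + C) := by
  choose c hc using fun i => exists_coordDegreeLE_mul b (b i)
  refine ⟨∑ i, c i, fun w u hu hw => ?_⟩
  rw [finrank_quotient_span_eq_natDegree_norm b hu, Algebra.norm_eq_matrix_det b,
    Matrix.det_apply]
  refine natDegree_sum_le_of_forall_le _ _ fun σ _ => ?_
  refine (natDegree_smul_le _ _).trans ((natDegree_prod_le _ _).trans ?_)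
  refine (Finset.sum_le_card_nsmul _ _ (w + ∑ i, c i) fun i _ => ?_).trans_eq (by simp)
  rw [Algebra.leftMulMatrix_eq_repr_mul, mul_comm]
  refine (hc i w u hw (σ i)).trans ?_
  gcongr
  exact Finset.single_le_sum (f := c) (fun _ _ => Nat.zero_le _) (Finset.mem_univ i)

lemma finiteDimensional_quotient_span_singleton [IsDomain R] [Algebra k R]
    [IsScalarTower k k[X] R] (b : Module.Basis ι k[X] R) {u : R} (hu : u ≠ 0) :
    FiniteDimensional k (R ⧸ Ideal.span ({u} : Set R)) := by
  have := Ideal.quotientEquivDirectSum k b (I := Ideal.span {u})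
    (by simpa [Ideal.span_singleton_eq_bot] using hu)
  exact Module.Finite.equiv this.symm

end CoordinateDegree

section LocalExpansion

variable {k R ι : Type*} [Field k] [CommRing R] [IsDomain R] [Algebra k[X] R] [Algebra k R]
  [IsScalarTower k k[X] R] [Fintype ι] [DecidableEq ι]

/-- The order of vanishing of a function at a point is bounded by its degree. -/
lemma exists_order_le (b : Module.Basis ι k[X] R) :
    ∃ C, ∀ (φ : R →ₐ[k] PowerSeries k) (τ : R), φ τ = PowerSeries.X →
      ∀ w u n, u ≠ 0 → CoordDegreeLE b w u → PowerSeries.X ^ n ∣ φ u →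
        n ≤ Fintype.card ι * (w + C) := by
  obtain ⟨C, hC⟩ := exists_finrank_quotient_le b
  refine ⟨C, fun φ τ hτ w u n hu hw hn => le_trans ?_ (hC w u hu hw)⟩
  have := finiteDimensional_quotient_span_singleton b hu
  have hli : LinearIndependent k
      (fun i : Fin n => Ideal.Quotient.mk (Ideal.span ({u} : Set R)) (τ ^ (i : ℕ))) := by
    rw [Fintype.linearIndependent_iff]
    intro g hg i
    have h1 : Ideal.Quotient.mk (Ideal.span ({u} : Set R)) (∑ i, g i • τ ^ (i : ℕ)) = 0 := by
      rw [map_sum, ← hg]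
      rfl
    rw [Ideal.Quotient.eq_zero_iff_mem, Ideal.mem_span_singleton] at h1
    have h2 := hn.trans (map_dvd φ h1)
    rw [map_sum, PowerSeries.X_pow_dvd_iff] at h2
    have h3 := h2 i i.2
    simpa [hτ, PowerSeries.coeff_X_pow, Fin.val_inj] using h3
  simpa using hli.fintype_card_le_finrank

/-- Linearly independent functions of small degree stay linearly independent over the field of
`p ^ e`-th powers of functions. -/
lemma exists_forall_eq_zero_of_sum_pow_mul_eq_zero (b : Module.Basis ι k[X] R)
    (p : ℕ) [Fact p.Prime] [CharP k p] (φ : R →ₐ[k] PowerSeries k) (τ : R)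
    (hτ : φ τ = PowerSeries.X) :
    ∃ C, ∀ w e, Fintype.card ι * (w + C) < p ^ e → ∀ {κ : Type} [Fintype κ] (v a : κ → R),
      LinearIndependent k v → (∀ i, CoordDegreeLE b w (v i)) →
      ∑ i, a i ^ p ^ e * v i = 0 → ∀ i, a i = 0 := by
  obtain ⟨C, hC⟩ := exists_order_le b
  refine ⟨C, fun w e he κ _ v a hv hw ha => ?_⟩
  have : CharP (PowerSeries k) p := charP_of_injective_algebraMap
    (FaithfulSMul.algebraMap_injective k (PowerSeries k)) p
  have hinj : ∀ u, φ u = 0 → u = 0 := by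
    intro u hu
    by_contra hne
    obtain ⟨w', hw'⟩ := exists_coordDegreeLE b u
    have := hC φ τ hτ w' u (Fintype.card ι * (w' + C) + 1) hne hw' (by simp [hu])
    omega
  have key : ∀ n i, PowerSeries.X ^ n ∣ φ (a i) := by
    intro n
    induction n with
    | zero => simp
    | succ n ih =>
      choose μ hμ using ih
      have h1 : ∑ i, μ i ^ p ^ e * φ (v i) = 0 := by
        have h2 := congrArg φ ha
        simp only [map_sum, map_mul, map_pow, hμ, map_zero, mul_pow, mul_assoc] at h2
        rw [← Finset.mul_sum] at h2
        exact (mul_eq_zero.1 h2).resolve_left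
          (pow_ne_zero _ (pow_ne_zero _ PowerSeries.X_ne_zero))
      have h2 : PowerSeries.X ^ p ^ e ∣
          φ (∑ i, (PowerSeries.constantCoeff (μ i)) ^ p ^ e • v i) := by
        rw [← dvd_neg, ← zero_sub, ← h1, map_sum, ← Finset.sum_sub_distrib]
        refine Finset.dvd_sum fun i _ => ?_
        rw [map_smul, Algebra.smul_def, ← sub_mul, map_pow]
        refine Dvd.dvd.mul_right ?_ _
        rw [← sub_pow_char_pow]
        refine pow_dvd_pow_of_dvd ?_ _
        rw [PowerSeries.X_dvd_iff]
        simp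
      have h3 : ∑ i, (PowerSeries.constantCoeff (μ i)) ^ p ^ e • v i = 0 := by
        by_contra hne
        refine absurd (hC φ τ hτ w _ _ hne ?_ h2) (not_le.2 he)
        refine CoordDegreeLE.sum _ _ fun i _ => ?_
        have := (hw i).smul (p := Polynomial.C (PowerSeries.constantCoeff (μ i) ^ p ^ e)) (v := 0)
          (by simp)
        rwa [← Polynomial.algebraMap_eq, algebraMap_smul] at this
      intro i
      have h4 := Fintype.linearIndependent_iff.1 hv _ h3 i
      have h5 := eq_zero_of_pow_eq_zero h4
      rw [← PowerSeries.X_dvd_iff] at h5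
      rw [hμ, pow_succ]
      exact mul_dvd_mul_left _ h5
  intro i
  refine hinj _ (PowerSeries.ext fun n => ?_)
  simpa using PowerSeries.X_pow_dvd_iff.1 (key (n + 1) i) n (Nat.lt_succ_self n)

end LocalExpansion

/-- At a point unramified over the line, functions on a plane curve expand as power series. -/
lemma exists_algHom_powerSeries {k : Type*} [Field k] {g : k[X][X]} (hg : g.Monic) {t₀ x₀ : k}
    (h0 : (g.map (evalRingHom t₀)).eval x₀ = 0)
    (h1 : (g.map (evalRingHom t₀)).derivative.eval x₀ ≠ 0) :
    ∃ (φ : AdjoinRoot g →ₐ[k] PowerSeries k) (τ : AdjoinRoot g), φ τ = PowerSeries.X := by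
  set θ : k[X] →ₐ[k] PowerSeries k := aeval (PowerSeries.C t₀ + PowerSeries.X) with hθ
  have hcc : (PowerSeries.constantCoeff (R := k)).comp θ.toRingHom = evalRingHom t₀ := by
    ext <;> simp [hθ]
  have hcc' : ∀ h : k[X][X],
      PowerSeries.constantCoeff ((h.map θ.toRingHom).eval (PowerSeries.C x₀)) =
        (h.map (evalRingHom t₀)).eval x₀ := by
    intro h
    rw [← hcc, ← Polynomial.map_map, eval_map (f := PowerSeries.constantCoeff)]
    conv_rhs => rw [← PowerSeries.constantCoeff_C x₀]
    rw [eval₂_at_apply]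
  obtain ⟨ξ, hξ, -⟩ := HenselianRing.is_henselian (R := PowerSeries k)
    (I := Ideal.span {PowerSeries.X}) (g.map θ.toRingHom) (hg.map _) (PowerSeries.C x₀)
    (by rw [Ideal.mem_span_singleton, PowerSeries.X_dvd_iff, hcc', h0])
    (by
      refine IsUnit.map _ ?_
      rw [PowerSeries.isUnit_iff_constantCoeff, derivative_map, hcc', ← derivative_map]
      exact isUnit_iff_ne_zero.2 h1)
  have hξ' : eval₂ (θ : k[X] →+* PowerSeries k) ξ g = 0 := by
    rw [IsRoot.def, eval_map] at hξ
    exact hξ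
  refine ⟨AdjoinRoot.liftAlgHom g θ ξ hξ', AdjoinRoot.of g (X - C t₀), ?_⟩
  rw [AdjoinRoot.liftAlgHom_of]
  simp [hθ]

section Stepanov

/-- Choice of the degrees of the auxiliary function. -/
lemma exists_auxiliary_degrees (n r c D : ℕ) (hn : 0 < n) :
    ∃ K M₀, ∀ M Q, M₀ ≤ M → M ≤ Q → ∃ l m, n * (l + D) < Q ∧
      r * (l * M + m + c * (n * M + n) + 1) < n * l * m ∧ n * m ≤ r * M + n * K ∧ n * l ≤ Q := by
  set B := r * (r + 2 * c * n + 1) with hB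
  set K := 4 * (B + 1) + 1 with hK
  refine ⟨K, r * K + 4 * n * (D + 1) + 1, fun M Q hM hQ => ⟨Q / (2 * n), r * M / n + K, ?_⟩⟩
  set l := Q / (2 * n) with hl
  set m := r * M / n + K with hm
  have h1 : 2 * n * l ≤ Q := Nat.mul_div_le _ _
  have h2 : Q < 2 * n * (l + 1) := Nat.lt_mul_div_succ _ (by positivity)
  have h3 : n * (r * M / n) ≤ r * M := Nat.mul_div_le _ _
  have h4 : r * M < n * (r * M / n + 1) := Nat.lt_mul_div_succ _ hn
  have h5 : r * M / n ≤ r * M := Nat.div_le_self _ _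
  have h6 : M ≤ 4 * n * l := by nlinarith [Nat.zero_le (n * D), Nat.zero_le (r * K)]
  have hnm : r * M + n * (4 * (B + 1)) ≤ n * m := by
    rw [hm, hK]; nlinarith
  refine ⟨by nlinarith [Nat.zero_le (r * K), Nat.zero_le (n * l)], ?_,
    by rw [hm, mul_add]; omega, by nlinarith [Nat.zero_le (n * l)]⟩
  have h7 : l * (r * M + n * (4 * (B + 1))) ≤ n * l * m := by
    calc l * (r * M + n * (4 * (B + 1))) ≤ l * (n * m) := Nat.mul_le_mul_left _ hnm
      _ = n * l * m := by ring
  refine lt_of_lt_of_le ?_ h7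
  have h8 : M * (B + 1) ≤ l * (n * (4 * (B + 1))) := by
    calc M * (B + 1) ≤ 4 * n * l * (B + 1) := Nat.mul_le_mul_right _ h6
      _ = _ := by ring
  have h9 : r * m ≤ r * (r * M) + r * K := by
    rw [hm, mul_add]; gcongr
  have hM1 : 1 ≤ M := by omega
  have h10 : r * (c * (n * M + n) + 1) ≤ r * (2 * c * n + 1) * M := by
    calc r * (c * (n * M + n) + 1) ≤ r * (c * (n * M + n * M) + M) := by
          gcongr; nlinarith
      _ = _ := by ring
  have h11 : r * K < M := by omega
  have : r * (r * M) + r * (2 * c * n + 1) * M = B * M := by rw [hB]; ring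
  nlinarith

lemma exists_linear_relation {k R ι κ : Type*} [Field k] [CommRing R] [Algebra k[X] R]
    [Algebra k R] [IsScalarTower k k[X] R] [Fintype ι] [Fintype κ]
    (b : Module.Basis ι k[X] R) (W : ℕ) (v : κ → R) (hv : ∀ s, CoordDegreeLE b W (v s))
    (hcard : Fintype.card ι * (W + 1) < Fintype.card κ) :
    ∃ g : κ → k, g ≠ 0 ∧ ∑ s, g s • v s = 0 := by
  by_contra! hcon
  have hli : LinearIndependent k
      (fun s => fun j : ι × Fin (W + 1) => (b.repr (v s) j.1).coeff j.2) := by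
    rw [Fintype.linearIndependent_iff]
    intro g hg
    by_contra! hne
    refine hcon g (fun h => by simp [h] at hne) ?_
    apply b.repr.injective
    rw [map_zero]
    ext i e
    have h1 : b.repr (∑ s, g s • v s) i = ∑ s, Polynomial.C (g s) * b.repr (v s) i := by
      simp only [map_sum, Finsupp.finsetSum_apply]
      refine Finset.sum_congr rfl fun s _ => ?_
      rw [← algebraMap_smul k[X] (g s) (v s), map_smul, Finsupp.smul_apply, smul_eq_mul,
        Polynomial.algebraMap_eq]
    rw [h1, finsetSum_coeff]
    simp only [coeff_C_mul, Finsupp.coe_zero, Pi.zero_apply, coeff_zero]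
    by_cases he : e < W + 1
    · simpa using congrFun hg (i, ⟨e, he⟩)
    · refine Finset.sum_eq_zero fun s _ => ?_
      rw [coeff_eq_zero_of_natDegree_lt ((hv s i).trans_lt (by omega)), mul_zero]
  have := hli.fintype_card_le_finrank
  simp at this
  omega

variable {k A R ι : Type*} [Field k] [IsAlgClosed k] [CommRing A] [IsDomain A]
  [Algebra k[X] A] [Algebra k A] [IsScalarTower k k[X] A]
  [CommRing R] [Algebra k[X] R] [Algebra k R] [IsScalarTower k k[X] R]
  [Fintype ι]

set_option maxHeartbeats 2000000 in
/-- The Stepanov method: on a curve of degree `n` over the line, a condition of degree `r` over the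
curve relating a point to its Frobenius image holds at no more than about `r * q ^ d` points. -/
theorem exists_card_le_of_frobenius_condition (p : ℕ) [Fact p.Prime] [CharP k p] {s n r : ℕ}
    (hs : 0 < s) (hn : 0 < n) (b : Module.Basis (Fin n) k[X] A) (x : A)
    (hb : ∀ i, b i = x ^ (i : ℕ))
    (φ : A →ₐ[k] PowerSeries k) (τ : A) (hτ : φ τ = PowerSeries.X)
    (b' : Module.Basis ι k[X] R) (hι : Fintype.card ι = n * r) (x' z' : R) :
    ∃ C d₀, ∀ d, d₀ ≤ d → ∀ S : Set (A →ₐ[k] k),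
      (∀ χ ∈ S, χ (algebraMap k[X] A X) ^ (p ^ s) ^ d = χ (algebraMap k[X] A X) ∧
        ∃ ψ : R →ₐ[k] k, ψ (algebraMap k[X] R X) = χ (algebraMap k[X] A X) ∧ ψ x' = χ x ∧
          ψ z' = χ x ^ (p ^ s) ^ d) →
      S.ncard ≤ r * (p ^ s) ^ d + C * (p ^ s) ^ (d - d / 2) := by
  obtain ⟨C₁, hC₁⟩ := exists_forall_eq_zero_of_sum_pow_mul_eq_zero b p φ τ hτ
  obtain ⟨C₂, hC₂⟩ := exists_finrank_quotient_le b
  obtain ⟨c₁, hc₁⟩ := exists_coordDegreeLE_smul_pow_mul_pow b x 1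
  obtain ⟨c₂, hc₂⟩ := exists_coordDegreeLE_smul_pow_mul_pow b' x' z'
  obtain ⟨K, M₀, hKM⟩ := exists_auxiliary_degrees n r c₂ (c₁ * (n + 1) + C₁) hn
  have hp1 : 1 < p := (Fact.out : p.Prime).one_lt
  have hq1 : 1 < p ^ s := Nat.one_lt_pow hs.ne' hp1
  refine ⟨1 + n * K + n * (c₁ * (2 * n + 1)) + n * C₂, 2 * M₀, fun d hd S hS => ?_⟩
  obtain ⟨l, m, hl1, hl2, hm, hl3⟩ := hKM ((p ^ s) ^ (d / 2)) ((p ^ s) ^ (d - d / 2))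
    ((show M₀ ≤ d / 2 by omega).trans (Nat.lt_pow_self hq1).le)
    (Nat.pow_le_pow_right (by omega) (by omega))
  set T := algebraMap k[X] A X with hT
  set T' := algebraMap k[X] R X with hT'
  set M := (p ^ s) ^ (d / 2) with hM
  set Q := (p ^ s) ^ (d - d / 2) with hQ
  have hMQ : (p ^ s) ^ d = M * Q := by rw [hM, hQ, ← pow_add]; congr 1; omega
  have hMp : M = p ^ (s * (d / 2)) := by rw [hM, ← pow_mul]
  have hQp : Q = p ^ (s * (d - d / 2)) := by rw [hQ, ← pow_mul]
  have hM0 : M ≠ 0 := by rw [hM]; positivity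
  have hQ0 : Q ≠ 0 := by rw [hQ]; positivity
  have hM1 : 1 ≤ M := Nat.one_le_iff_ne_zero.2 hM0
  have hQ1 : 1 ≤ Q := Nat.one_le_iff_ne_zero.2 hQ0
  have : CharP A p := charP_of_injective_algebraMap (FaithfulSMul.algebraMap_injective k A) p
  obtain ⟨g, hg0, hg⟩ := exists_linear_relation (κ := (Fin l × Fin n) × (Fin m × Fin n)) b'
    (l * M + m + c₂ * (n * M + n))
    (fun s => (X ^ ((s.1.1 : ℕ) * M + s.2.1) : k[X]) •
      (x' ^ ((s.1.2 : ℕ) * M) * z' ^ (s.2.2 : ℕ)))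
    (fun s => by
      refine (hc₂ _ _ _).mono ?_
      have h1 : ((s.1.1 : ℕ) + 1) * M ≤ l * M := Nat.mul_le_mul_right _ s.1.1.2
      have h2 : ((s.1.2 : ℕ)) * M ≤ n * M := Nat.mul_le_mul_right _ s.1.2.2.le
      have h3 : ((s.2.1 : ℕ)) ≤ m := s.2.1.2.le
      have h4 : c₂ * ((s.1.2 : ℕ) * M + s.2.2 + 1) ≤ c₂ * (n * M + n) := by
        gcongr c₂ * ?_
        have := s.2.2.2
        omega
      nlinarith)
    (by
      rw [hι]
      simp only [Fintype.card_prod, Fintype.card_fin]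
      calc n * r * (l * M + m + c₂ * (n * M + n) + 1)
          = n * (r * (l * M + m + c₂ * (n * M + n) + 1)) := by ring
        _ < n * (n * l * m) := Nat.mul_lt_mul_of_pos_left hl2 hn
        _ = l * n * (m * n) := by ring)
  choose e he using fun s => IsAlgClosed.exists_pow_nat_eq (g s)
    (n := M * Q) (Nat.mul_pos hM1 hQ1)
  set v : Fin l × Fin n → A := fun s => (X ^ (s.1 : ℕ) : k[X]) • x ^ (s.2 : ℕ) with hv
  set u : Fin l × Fin n → A := fun s => ∑ t : Fin m × Fin n,
    e (s, t) • ((X ^ (t.1 : ℕ) : k[X]) • x ^ (t.2 : ℕ)) with hu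
  have hmon : ∀ N : ℕ, LinearIndependent k
      fun s : Fin N × Fin n => (X ^ (s.1 : ℕ) : k[X]) • x ^ (s.2 : ℕ) := by
    intro N
    have h1 : LinearIndependent k fun i : Fin N => (X ^ (i : ℕ) : k[X]) := by
      have := (Polynomial.basisMonomials k).linearIndependent.comp
        (fun i : Fin N => (i : ℕ)) Fin.val_injective
      simpa [Function.comp_def, Polynomial.X_pow_eq_monomial] using this
    have h2 := linearIndependent_smul h1 b.linearIndependent
    simpa only [hb] using h2
  set h := ∑ s, u s ^ Q * v s with hh
  have hne : h ≠ 0 := by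
    intro h0
    apply hg0
    have h1 := hC₁ (l + c₁ * (n + 1)) (s * (d - d / 2))
      (by rw [← hQp, Fintype.card_fin]; calc
            n * (l + c₁ * (n + 1) + C₁) = n * (l + (c₁ * (n + 1) + C₁)) := by ring
            _ < Q := hl1) v u (hmon l)
      (fun i => by
        have := hc₁ i.1 i.2 0
        simp only [pow_zero, mul_one] at this
        refine this.mono ?_
        have := i.1.2
        have := i.2.2
        gcongr
        omega)
      (by rw [← hQp]; exact h0)
    funext w
    have h2 := Fintype.linearIndependent_iff.1 (hmon m) (fun t => e (w.1, t)) (h1 w.1) w.2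
    rw [← he w]
    simp only [Prod.mk.eta] at h2
    simp [h2, hM0, hQ0]
  have hdeg : CoordDegreeLE b (l + m * Q + c₁ * (n + n * Q + 1)) h := by
    refine CoordDegreeLE.sum _ _ fun s _ => ?_
    rw [hu, hQp, sum_pow_char_pow, Finset.sum_mul, ← hQp]
    refine CoordDegreeLE.sum _ _ fun t _ => ?_
    have h1 := hc₁ (s.1 + t.1 * Q) (s.2 + t.2 * Q) 0
    have h2 : (e (s, t) • (X ^ (t.1 : ℕ) : k[X]) • x ^ (t.2 : ℕ)) ^ Q * v s =
        (Polynomial.C (e (s, t) ^ Q)) •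
          ((X ^ ((s.1 : ℕ) + t.1 * Q) : k[X]) • (x ^ ((s.2 : ℕ) + t.2 * Q) * 1 ^ 0)) := by
      rw [← Polynomial.algebraMap_eq, algebraMap_smul]
      simp only [hv, Algebra.smul_def, map_pow]
      ring
    rw [h2]
    refine CoordDegreeLE.mono ?_ (CoordDegreeLE.smul (v := 0) (by simp) h1)
    have h3 : ((t.1 : ℕ)) * Q ≤ m * Q := Nat.mul_le_mul_right _ t.1.2.le
    have h4 : ((t.2 : ℕ)) * Q ≤ n * Q := Nat.mul_le_mul_right _ t.2.2.le
    have := s.1.2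
    have := s.2.2
    rw [add_zero, add_zero]
    gcongr ?_ + _ * ?_ <;> omega
  have hzero : ∀ χ ∈ S, χ h = 0 := by
    intro χ hχ
    obtain ⟨hT1, ψ, hψT, hψx, hψz⟩ := hS χ hχ
    have h1 := congrArg ψ hg
    refine eq_zero_of_pow_eq_zero (n := M) ?_
    rw [map_zero, map_sum, Fintype.sum_prod_type] at h1
    rw [← h1, hh, map_sum, hMp, sum_pow_char_pow, ← hMp]
    refine Finset.sum_congr rfl fun s _ => ?_
    rw [map_mul, map_pow, mul_pow, ← pow_mul, mul_comm Q M, ← hMQ, hu, map_sum, ← pow_mul,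
      sum_pow_char_pow, pow_mul, Finset.sum_mul]
    refine Finset.sum_congr rfl fun t _ => ?_
    rw [← hMQ] at he
    simp only [hv, Algebra.smul_def, map_pow, map_mul, AlgHom.commutes, ← he, ← hT, ← hT', hψT,
      hψx, hψz, Algebra.algebraMap_self, RingHom.id_apply, mul_pow]
    rw [← pow_mul _ (t.1 : ℕ), mul_comm (t.1 : ℕ), pow_mul, hT1]
    ring
  have hcard : S.ncard ≤ n * (l + m * Q + c₁ * (n + n * Q + 1) + C₂) := by
    have hfd := finiteDimensional_quotient_span_singleton b hne
    refine le_trans ?_ ((card_algHom_le_finrank k (A ⧸ Ideal.span ({h} : Set A)) k).trans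
      ((hC₂ _ _ hne hdeg).trans_eq (by rw [Fintype.card_fin])))
    rw [← Nat.card_coe_set_eq]
    refine Nat.card_le_card_of_injective (fun χ : S => Ideal.Quotient.liftₐ
      (Ideal.span ({h} : Set A)) χ.1 fun a ha => ?_) ?_
    · obtain ⟨y, rfl⟩ := Ideal.mem_span_singleton.1 ha
      rw [map_mul, hzero χ.1 χ.2, zero_mul]
    · intro χ₁ χ₂ h12
      refine Subtype.ext (AlgHom.ext fun a => ?_)
      exact DFunLike.congr_fun h12 (Ideal.Quotient.mk _ a)
  refine hcard.trans ?_
  rw [hMQ]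
  have h1 : n * m * Q ≤ (r * M + n * K) * Q := Nat.mul_le_mul_right _ hm
  have h2 : n * (c₁ * (n + n * Q + 1)) ≤ n * (c₁ * (2 * n + 1)) * Q := by
    calc n * (c₁ * (n + n * Q + 1)) ≤ n * (c₁ * (n * Q + n * Q + Q)) := by
          gcongr; nlinarith
      _ = _ := by ring
  have h3 : n * C₂ ≤ n * C₂ * Q := Nat.le_mul_of_pos_right _ hQ1
  nlinarith

end Stepanov

section PointCount

open scoped Classical in
/-- The elements of `k` fixed by the `Q`-power map. -/
noncomputable def powFixed (k : Type*) [Field k] (Q : ℕ) : Finset k :=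
  ((X : k[X]) ^ Q - X).roots.toFinset

lemma mem_powFixed {k : Type*} [Field k] {Q : ℕ} (hQ : 1 < Q) {t : k} :
    t ∈ powFixed k Q ↔ t ^ Q = t := by
  simp [powFixed, FiniteField.X_pow_card_sub_X_ne_zero k hQ, sub_eq_zero]

lemma card_powFixed {k : Type*} [Field k] [IsAlgClosed k] (p : ℕ) [Fact p.Prime] [CharP k p]
    {e : ℕ} (he : 0 < e) : (powFixed k (p ^ e)).card = p ^ e := by
  classical
  rw [powFixed, Multiset.toFinset_card_of_nodup, IsAlgClosed.card_roots_eq_natDegree,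
    FiniteField.X_pow_card_sub_X_natDegree_eq k (Nat.one_lt_pow he.ne' (Fact.out : p.Prime).one_lt)]
  exact nodup_roots (galois_poly_separable p (p ^ e) (dvd_pow_self p he.ne'))

variable {k : Type*} [Field k] [IsAlgClosed k]

/-- `exists_card_le_of_frobenius_condition` for a plane curve, in terms of points. -/
lemma exists_card_le_of_frobenius_condition_of_irreducible (p : ℕ) [Fact p.Prime] [CharP k p]
    {s : ℕ} (hs : 0 < s) {g : k[X][X]} (hg : g.Monic) (hdeg : 0 < g.natDegree)
    (hirr : Irreducible g)
    {t₀ x₀ : k} (h0 : (g.map (evalRingHom t₀)).eval x₀ = 0)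
    (h1 : (g.map (evalRingHom t₀)).derivative.eval x₀ ≠ 0)
    {R ι : Type*} [CommRing R] [Algebra k[X] R] [Algebra k R] [IsScalarTower k k[X] R]
    [Fintype ι] {r : ℕ} (b' : Module.Basis ι k[X] R) (hι : Fintype.card ι = g.natDegree * r)
    (x' z' : R) :
    ∃ C d₀, ∀ d, d₀ ≤ d → ∀ Z : Finset (k × k),
      (∀ P ∈ Z, P.1 ^ (p ^ s) ^ d = P.1 ∧ (g.map (evalRingHom P.1)).eval P.2 = 0 ∧
        ∀ χ : AdjoinRoot g →ₐ[k] k, χ (algebraMap k[X] _ X) = P.1 → χ (AdjoinRoot.root g) = P.2 →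
          ∃ ψ : R →ₐ[k] k, ψ (algebraMap k[X] R X) = P.1 ∧ ψ x' = P.2 ∧
            ψ z' = P.2 ^ (p ^ s) ^ d) →
      Z.card ≤ r * (p ^ s) ^ d + C * (p ^ s) ^ (d - d / 2) := by
  have hprime : Fact (Prime g) := ⟨hirr.prime⟩
  have : IsDomain (AdjoinRoot g) := AdjoinRoot.isDomain_of_prime hirr.prime
  obtain ⟨φ, τ, hτ⟩ := exists_algHom_powerSeries hg h0 h1
  obtain ⟨C, d₀, hC⟩ := exists_card_le_of_frobenius_condition p hs hdeg
    ((AdjoinRoot.powerBasis' hg).basis.reindex (finCongr (AdjoinRoot.powerBasis'_dim hg)))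
    (AdjoinRoot.root g) (fun i => by
      rw [Module.Basis.reindex_apply, PowerBasis.basis_eq_pow, AdjoinRoot.powerBasis'_gen]; rfl)
    φ τ hτ b' hι x' z'
  refine ⟨C, d₀, fun d hd Z hZ => ?_⟩
  have hχ : ∀ P : Z, ∃ χ : AdjoinRoot g →ₐ[k] k,
      χ (algebraMap k[X] _ X) = P.1.1 ∧ χ (AdjoinRoot.root g) = P.1.2 := by
    intro P
    have h2 : eval₂ ((aeval P.1.1 : k[X] →ₐ[k] k) : k[X] →+* k) P.1.2 g = 0 := by
      rw [← (hZ P.1 P.2).2.1, eval_map]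
      congr 1
    refine ⟨AdjoinRoot.liftAlgHom g (aeval P.1.1) P.1.2 h2, ?_, ?_⟩
    · rw [AdjoinRoot.algebraMap_eq, AdjoinRoot.liftAlgHom_of, aeval_X]
    · rw [AdjoinRoot.liftAlgHom_root]
  choose χ hχ1 hχ2 using hχ
  have hinj : Function.Injective χ := by
    intro P₁ P₂ h
    refine Subtype.ext (Prod.ext ?_ ?_)
    · rw [← hχ1, ← hχ1, h]
    · rw [← hχ2, ← hχ2, h]
  have h2 := hC d hd (Set.range χ) (by
    rintro _ ⟨P, rfl⟩
    obtain ⟨h3, -, h4⟩ := hZ P.1 P.2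
    rw [hχ1, hχ2]
    exact ⟨h3, h4 _ (hχ1 P) (hχ2 P)⟩)
  rwa [← Nat.card_coe_set_eq, Nat.card_range_of_injective hinj, Nat.card_eq_fintype_card,
    Fintype.card_coe] at h2

open scoped Classical in
/-- The number of `Q`-rational points of a plane curve. -/
noncomputable def curvePointCount (g : k[X][X]) (Q : ℕ) : ℕ :=
  ∑ t ∈ powFixed k Q, ((g.map (evalRingHom t)).roots.toFinset.filter fun x => x ^ Q = x).card

end PointCount

section PointBounds

variable {k : Type*} [Field k]

lemma eval_pow_of_map_iterateFrobenius_eq {p s : ℕ} [ExpChar k p] {g : k[X][X]}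
    (hg : g.map (mapRingHom (iterateFrobenius k p s)) = g) (d : ℕ) {t : k}
    (ht : t ^ (p ^ s) ^ d = t) (x : k) :
    ((g.map (evalRingHom t)).eval x) ^ (p ^ s) ^ d =
      (g.map (evalRingHom t)).eval (x ^ (p ^ s) ^ d) := by
  have h1 : ∀ (e : ℕ) (t x : k), ((g.map (evalRingHom t)).eval x) ^ (p ^ s) ^ e =
      (g.map (evalRingHom (t ^ (p ^ s) ^ e))).eval (x ^ (p ^ s) ^ e) := by
    intro e
    induction e with
    | zero => simp
    | succ e ih =>
      intro t x
      rw [pow_succ, pow_mul, ih, pow_mul t, pow_mul x, ← iterateFrobenius_def p s,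
        ← iterateFrobenius_def p s,
        ← iterateFrobenius_def p s, ← eval₂_at_apply, ← eval_map, Polynomial.map_map]
      conv_rhs => rw [← hg, Polynomial.map_map]
      congr 2
      ext <;> simp
  rw [h1, ht]

/-- The `k[X]`-basis of a two-step extension obtained by adjoining roots. -/
noncomputable def adjoinRootTowerBasis {g : k[X][X]} (hg : g.Monic) {m : ℕ} (h : (AdjoinRoot g)[X])
    (hm : h.Monic) (hdeg : h.natDegree = m) :
    Module.Basis (Fin g.natDegree × Fin m) k[X] (AdjoinRoot h) :=
  ((AdjoinRoot.powerBasis' hg).basis.reindex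
    (finCongr (AdjoinRoot.powerBasis'_dim hg))).smulTower ((AdjoinRoot.powerBasis' hm).basis.reindex
    (finCongr ((AdjoinRoot.powerBasis'_dim hm).trans hdeg)))

variable [IsAlgClosed k]

open scoped Classical in
lemma natDegree_mul_le_card_roots {g : k[X][X]} (hg : g.Monic) {u v : k[X][X]} {D : k[X]}
    (hD : D ≠ 0) (huv : u * g + v * derivative g = C D) (S : Finset k) :
    g.natDegree * S.card ≤ (∑ t ∈ S, ((g.map (evalRingHom t)).roots.toFinset).card) +
      g.natDegree * D.natDegree := by
  have h1 : ∀ t, D.eval t ≠ 0 → ((g.map (evalRingHom t)).roots.toFinset).card = g.natDegree := by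
    intro t ht
    have h2 : (g.map (evalRingHom t)).Separable := by
      refine ⟨C (D.eval t)⁻¹ * u.map (evalRingHom t), C (D.eval t)⁻¹ * v.map (evalRingHom t), ?_⟩
      have h3 := congrArg (Polynomial.map (evalRingHom t)) huv
      rw [Polynomial.map_add, Polynomial.map_mul, Polynomial.map_mul, map_C, ← derivative_map] at h3
      rw [mul_assoc, mul_assoc, ← mul_add, h3, ← C_mul, coe_evalRingHom, inv_mul_cancel₀ ht, C_1]
    rw [Multiset.toFinset_card_of_nodup (nodup_roots h2), IsAlgClosed.card_roots_eq_natDegree,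
      hg.natDegree_map]
  have h2 : S.card ≤ (S.filter fun t => D.eval t ≠ 0).card + D.natDegree := by
    rw [← Finset.card_filter_add_card_filter_not (fun t => D.eval t ≠ 0)]
    gcongr
    refine le_trans (Finset.card_le_card ?_) ((Multiset.toFinset_card_le _).trans (card_roots' D))
    intro t ht
    simp at ht
    simp [hD, ht.2]
  calc g.natDegree * S.card
      ≤ g.natDegree * ((S.filter fun t => D.eval t ≠ 0).card + D.natDegree) := by
        gcongr
    _ = (∑ t ∈ S.filter fun t => D.eval t ≠ 0, ((g.map (evalRingHom t)).roots.toFinset).card) +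
      g.natDegree * D.natDegree := by
        rw [Finset.sum_congr rfl (fun t ht => h1 t (Finset.mem_filter.1 ht).2), Finset.sum_const]
        ring_nf
    _ ≤ _ := by
      gcongr
      exact Finset.filter_subset _ _

end PointBounds

section PointCountBound

variable {k : Type*} [Field k] [IsAlgClosed k]

open scoped Classical in
lemma exists_curvePointCount_le (p : ℕ) [Fact p.Prime] [CharP k p]
    {s : ℕ} (hs : 0 < s) {g : k[X][X]} (hg : g.Monic) (hdeg : 0 < g.natDegree)
    (hirr : Irreducible g)
    {t₀ x₀ : k} (h0 : (g.map (evalRingHom t₀)).eval x₀ = 0)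
    (h1 : (g.map (evalRingHom t₀)).derivative.eval x₀ ≠ 0) :
    ∃ C d₀, ∀ d, d₀ ≤ d →
      curvePointCount g ((p ^ s) ^ d) ≤ (p ^ s) ^ d + C * (p ^ s) ^ (d - d / 2) := by
  obtain ⟨C, d₀, h⟩ := exists_card_le_of_frobenius_condition_of_irreducible p hs hg hdeg hirr h0 h1
    ((AdjoinRoot.powerBasis' hg).basis.reindex (finCongr (AdjoinRoot.powerBasis'_dim hg)))
    (r := 1) (by simp) (AdjoinRoot.root g) (AdjoinRoot.root g)
  refine ⟨C, max d₀ 1, fun d hd => ?_⟩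
  have hQ : 1 < (p ^ s) ^ d := by
    rw [← pow_mul]
    refine Nat.one_lt_pow ?_ (Fact.out : p.Prime).one_lt
    have : 1 ≤ d := le_of_max_le_right hd
    positivity
  have h2 := h d (le_of_max_le_left hd) (((powFixed k ((p ^ s) ^ d)).sigma fun t =>
    ((g.map (evalRingHom t)).roots.toFinset.filter fun x => x ^ (p ^ s) ^ d = x)).map
      (Equiv.sigmaEquivProd k k).toEmbedding) (by
    intro P hP
    obtain ⟨⟨t, x⟩, hM, rfl⟩ := Finset.mem_map.1 hP
    simp only [Finset.mem_sigma, mem_powFixed hQ, Finset.mem_filter, Multiset.mem_toFinset] at hM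
    obtain ⟨ht, hx, hx'⟩ := hM
    refine ⟨ht, (mem_roots'.1 hx).2, fun χ h3 h4 => ⟨χ, h3, h4, ?_⟩⟩
    rw [h4]
    exact hx'.symm)
  rwa [Finset.card_map, Finset.card_sigma, one_mul] at h2

open scoped Classical in
lemma exists_card_nonrational_le (p : ℕ) [Fact p.Prime] [CharP k p]
    {s : ℕ} (hs : 0 < s) {g : k[X][X]} (hg : g.Monic) (hdeg : 0 < g.natDegree)
    (hirr : Irreducible g)
    (hfrob : g.map (mapRingHom (iterateFrobenius k p s)) = g)
    {t₀ x₀ : k} (h0 : (g.map (evalRingHom t₀)).eval x₀ = 0)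
    (h1 : (g.map (evalRingHom t₀)).derivative.eval x₀ ≠ 0) :
    ∃ C d₀, ∀ d, d₀ ≤ d →
      ∑ t ∈ powFixed k ((p ^ s) ^ d), ((g.map (evalRingHom t)).roots.toFinset.filter
        fun x => x ^ (p ^ s) ^ d ≠ x).card ≤
      (g.natDegree - 1) * (p ^ s) ^ d + C * (p ^ s) ^ (d - d / 2) := by
  have : IsDomain (AdjoinRoot g) := AdjoinRoot.isDomain_of_prime hirr.prime
  set A := AdjoinRoot g
  set x : A := AdjoinRoot.root g
  set h := (g.map (algebraMap k[X] A)) /ₘ (X - C x) with hh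
  have hmul : (X - C x) * h = g.map (algebraMap k[X] A) := by
    rw [hh, mul_divByMonic_eq_iff_isRoot]
    simp only [IsRoot, eval_map, x, A, AdjoinRoot.algebraMap_eq, AdjoinRoot.eval₂_root]
  have hmon : h.Monic := Monic.of_mul_monic_left (monic_X_sub_C x) (by
    rw [hmul]; exact hg.map _)
  have hnat : h.natDegree = g.natDegree - 1 := by
    rw [hh, natDegree_divByMonic _ (monic_X_sub_C x), natDegree_X_sub_C, hg.natDegree_map]
  obtain ⟨C, d₀, hC⟩ := exists_card_le_of_frobenius_condition_of_irreducible p hs hg hdeg hirr h0 h1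
    (adjoinRootTowerBasis hg h hmon hnat)
    (r := g.natDegree - 1) (by simp) (algebraMap A _ x) (AdjoinRoot.root h)
  refine ⟨C, max d₀ 1, fun d hd => ?_⟩
  have hQ : 1 < (p ^ s) ^ d := by
    rw [← pow_mul]
    refine Nat.one_lt_pow ?_ (Fact.out : p.Prime).one_lt
    have : 1 ≤ d := le_of_max_le_right hd
    positivity
  have h2 := hC d (le_of_max_le_left hd) (((powFixed k ((p ^ s) ^ d)).sigma fun t =>
    ((g.map (evalRingHom t)).roots.toFinset.filter fun x => x ^ (p ^ s) ^ d ≠ x)).map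
      (Equiv.sigmaEquivProd k k).toEmbedding) (by
    intro P hP
    obtain ⟨⟨t, y⟩, hM, rfl⟩ := Finset.mem_map.1 hP
    simp only [Finset.mem_sigma, mem_powFixed hQ, Finset.mem_filter, Multiset.mem_toFinset] at hM
    obtain ⟨ht, hy, hy'⟩ := hM
    have hy0 := (mem_roots'.1 hy).2
    refine ⟨ht, hy0, fun χ h3 h4 => ?_⟩
    simp only [Equiv.coe_toEmbedding, Equiv.sigmaEquivProd_apply] at h3 h4 ⊢
    have h5 : (χ : A →+* k).comp (algebraMap k[X] A) = evalRingHom t := by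
      refine ringHom_ext (fun a => ?_) (h3.trans (by simp))
      have : algebraMap k[X] A (Polynomial.C a) = algebraMap k A a := by
        rw [← Polynomial.algebraMap_eq, ← IsScalarTower.algebraMap_apply]
      simp [this]
    have h6 : eval₂ (χ : A →+* k) (y ^ (p ^ s) ^ d) h = 0 := by
      have h7 := congrArg (eval₂ (χ : A →+* k) (y ^ (p ^ s) ^ d)) hmul
      rw [eval₂_mul, eval₂_map, h5, ← eval_map (evalRingHom t),
        ← eval_pow_of_map_iterateFrobenius_eq hfrob d ht,
        IsRoot.def.1 hy0, zero_pow (by positivity), mul_eq_zero] at h7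
      refine h7.resolve_left ?_
      have h8 : (χ : A →+* k) x = y := h4
      rw [eval₂_sub, eval₂_X, eval₂_C, h8]
      exact sub_ne_zero.2 hy'
    refine ⟨AdjoinRoot.liftAlgHom h χ (y ^ (p ^ s) ^ d) h6, ?_, ?_, ?_⟩
    · rw [IsScalarTower.algebraMap_apply k[X] A (AdjoinRoot h), AdjoinRoot.algebraMap_eq h,
        AdjoinRoot.liftAlgHom_of, h3]
    · rw [AdjoinRoot.algebraMap_eq h, AdjoinRoot.liftAlgHom_of, h4]
    · rw [AdjoinRoot.liftAlgHom_root])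
  rwa [Finset.card_map, Finset.card_sigma] at h2

/-- A plane curve over a finite field which is irreducible over the algebraic closure has
`Q + O(Q')` points over the field with `Q` elements, where `Q'` is about `√Q`. -/
theorem exists_abs_curvePointCount_sub_le (p : ℕ) [Fact p.Prime] [CharP k p]
    {s : ℕ} (hs : 0 < s) {g : k[X][X]} (hg : g.Monic) (hdeg : 0 < g.natDegree)
    (hirr : Irreducible g)
    (hfrob : g.map (mapRingHom (iterateFrobenius k p s)) = g) {u v : k[X][X]} {D : k[X]}
    (hD : D ≠ 0) (huv : u * g + v * derivative g = C D) :
    ∃ C d₀ : ℕ, ∀ d, d₀ ≤ d →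
      |(curvePointCount g ((p ^ s) ^ d) : ℤ) - (p ^ s) ^ d| ≤ C * (p ^ s) ^ (d - d / 2) := by
  classical
  obtain ⟨t₀, ht₀⟩ : ∃ t₀, D.eval t₀ ≠ 0 := by
    by_contra! h
    exact hD (Polynomial.funext (by simpa using h))
  obtain ⟨x₀, h0⟩ := IsAlgClosed.exists_root (g.map (evalRingHom t₀)) (by
    rw [degree_eq_natDegree (hg.map _).ne_zero, hg.natDegree_map]; exact_mod_cast hdeg.ne')
  have h1 : (g.map (evalRingHom t₀)).derivative.eval x₀ ≠ 0 := by
    intro h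
    have h3 := congrArg (fun P => (Polynomial.map (evalRingHom t₀) P).eval x₀) huv
    simp only [Polynomial.map_add, Polynomial.map_mul, map_C, ← derivative_map, eval_add, eval_mul,
      h0.eq_zero, h, mul_zero, add_zero, eval_C, coe_evalRingHom] at h3
    exact ht₀ h3.symm
  obtain ⟨C₁, d₁, hC₁⟩ := exists_curvePointCount_le p hs hg hdeg hirr h0 h1
  obtain ⟨C₂, d₂, hC₂⟩ := exists_card_nonrational_le p hs hg hdeg hirr hfrob h0 h1
  refine ⟨C₁ + C₂ + g.natDegree * D.natDegree, max (max d₁ d₂) 1, fun d hd => ?_⟩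
  have hd1 : 1 ≤ d := le_of_max_le_right hd
  have hm := le_of_max_le_left hd
  replace hC₁ := hC₁ d (le_of_max_le_left hm)
  replace hC₂ := hC₂ d (le_of_max_le_right hm)
  have h4 := natDegree_mul_le_card_roots hg hD huv (powFixed k ((p ^ s) ^ d))
  have h5 : (powFixed k ((p ^ s) ^ d)).card = (p ^ s) ^ d := by
    rw [← pow_mul]; exact card_powFixed p (by positivity)
  have h6 : ∑ t ∈ powFixed k ((p ^ s) ^ d), ((g.map (evalRingHom t)).roots.toFinset).card =
      curvePointCount g ((p ^ s) ^ d) +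
      ∑ t ∈ powFixed k ((p ^ s) ^ d), ((g.map (evalRingHom t)).roots.toFinset.filter
        fun x => x ^ (p ^ s) ^ d ≠ x).card := by
    rw [curvePointCount, ← Finset.sum_add_distrib]
    exact Finset.sum_congr rfl fun t _ => (Finset.card_filter_add_card_filter_not _).symm
  rw [h5, h6] at h4
  have h7 : 1 ≤ (p ^ s) ^ (d - d / 2) := Nat.one_le_pow _ _ (pow_pos (Fact.out : p.Prime).pos _)
  have h8 : g.natDegree * D.natDegree ≤ g.natDegree * D.natDegree * (p ^ s) ^ (d - d / 2) :=
    Nat.le_mul_of_pos_right _ h7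
  obtain ⟨m, hm⟩ : ∃ m, g.natDegree = m + 1 := ⟨g.natDegree - 1, by omega⟩
  rw [hm] at h4 h8 hC₂ ⊢
  rw [Nat.add_sub_cancel] at hC₂
  set Q := (p ^ s) ^ d
  set Q' := (p ^ s) ^ (d - d / 2)
  have e : ((p : ℤ) ^ s) ^ d = (Q : ℤ) := by simp [Q]
  have e' : ((p : ℤ) ^ s) ^ (d - d / 2) = (Q' : ℤ) := by simp [Q']
  rw [e, e', abs_le]
  zify at h4 h8 hC₁ hC₂
  push_cast
  constructor <;> nlinarith [mul_nonneg (Int.natCast_nonneg C₁) (Int.natCast_nonneg Q'),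
    mul_nonneg (Int.natCast_nonneg C₂) (Int.natCast_nonneg Q')]

end PointCountBound

section Normalization

lemma irreducible_integralNormalization {R : Type*} [CommRing R] [IsDomain R] [IsGCDMonoid R]
    {f : R[X]} (hf : Irreducible f) (hdeg : 1 ≤ f.natDegree) :
    Irreducible f.integralNormalization := by
  have hprim : f.IsPrimitive := hf.isPrimitive (by omega)
  have hmon : f.integralNormalization.Monic := monic_integralNormalization hf.ne_zero
  set K := FractionRing R
  have hK := (hprim.irreducible_iff_irreducible_map_fraction_map (K := K)).1 hf
  refine (hmon.isPrimitive.irreducible_iff_irreducible_map_fraction_map (K := K)).2 ?_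
  have hlc : algebraMap R K f.leadingCoeff ≠ 0 := by
    simpa using hf.ne_zero
  have h1 := integralNormalization_eval₂_leadingCoeff_mul hdeg
    ((Polynomial.C : K →+* K[X]).comp (algebraMap R K)) X
  let _ : Invertible (algebraMap R K f.leadingCoeff) := invertibleOfNonzero hlc
  rw [← MulEquiv.irreducible_iff (algEquivCMulXAddC (algebraMap R K f.leadingCoeff) 0)]
  have h2 : algEquivCMulXAddC (algebraMap R K f.leadingCoeff) 0
      (f.integralNormalization.map (algebraMap R K)) =
      Polynomial.C (algebraMap R K f.leadingCoeff) ^ (f.natDegree - 1) *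
        f.map (algebraMap R K) := by
    rw [algEquivCMulXAddC_apply, C_0, add_zero, aeval_def, eval₂_map]
    refine h1.trans ?_
    rw [← eval₂_map, eval₂_C_X]
    rfl
  rw [h2, irreducible_isUnit_mul]
  · exact hK
  · exact ((isUnit_C.2 hlc.isUnit).pow _)

lemma derivative_integralNormalization_ne_zero {R : Type*} [CommRing R] [IsDomain R]
    {f : R[X]} (hdeg : 1 ≤ f.natDegree) (hf : derivative f ≠ 0) :
    derivative f.integralNormalization ≠ 0 := by
  contrapose! hf
  have hf0 : f ≠ 0 := by rintro rfl; simp at hdeg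
  ext i
  have h1 := congrArg (fun P => coeff P i) hf
  simp only [coeff_derivative, coeff_zero, mul_eq_zero] at h1 ⊢
  refine h1.imp_left fun h => ?_
  have h2 := integralNormalization_coeff_mul_leadingCoeff_pow (i + 1) hdeg
  rw [h, zero_mul, eq_comm, mul_eq_zero] at h2
  exact h2.resolve_right (pow_ne_zero _ (by simpa using hf0))

lemma exists_mul_add_mul_eq_C {R K : Type*} [CommRing R] [IsDomain R] [Field K] [Algebra R K]
    [IsFractionRing R K] {f g : R[X]}
    (h : IsCoprime (f.map (algebraMap R K)) (g.map (algebraMap R K))) :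
    ∃ u v : R[X], ∃ D : R, D ≠ 0 ∧ u * f + v * g = C D := by
  obtain ⟨a, b, hab⟩ := h
  obtain ⟨c, hc, hc'⟩ := IsLocalization.integerNormalization_spec (nonZeroDivisors R) a
  obtain ⟨d, hd, hd'⟩ := IsLocalization.integerNormalization_spec (nonZeroDivisors R) b
  refine ⟨C d * IsLocalization.integerNormalization (nonZeroDivisors R) a,
    C c * IsLocalization.integerNormalization (nonZeroDivisors R) b, c * d,
    mul_ne_zero (nonZeroDivisors.ne_zero hc) (nonZeroDivisors.ne_zero hd), ?_⟩
  apply map_injective (algebraMap R K) (IsFractionRing.injective R K)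
  rw [Polynomial.map_add, Polynomial.map_mul, Polynomial.map_mul, Polynomial.map_mul,
    Polynomial.map_mul, hc', hd', map_C, map_C, map_C, Algebra.smul_def, Algebra.smul_def]
  simp only [IsScalarTower.algebraMap_apply R K K[X], Polynomial.algebraMap_eq, map_mul]
  linear_combination (C (algebraMap R K c) * C (algebraMap R K d)) * hab

end Normalization

section FinitePolynomials

variable (k : Type*) [Field k] [Fintype k]

lemma finite_setOf_degree_lt (n : ℕ) : {P : k[X] | P.degree < n}.Finite := by
  have h : Finite (degreeLT k n) := Finite.of_equiv _ (degreeLTEquiv k n).symm.toEquiv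
  refine (Set.toFinite (degreeLT k n : Set k[X])).subset fun P hP => ?_
  exact mem_degreeLT.2 hP

/-- The finite set of polynomials of degree less than `n` over a finite field. -/
noncomputable def lowDegree (n : ℕ) : Finset k[X] := (finite_setOf_degree_lt k n).toFinset

variable {k}

@[simp]
lemma mem_lowDegree {n : ℕ} {P : k[X]} : P ∈ lowDegree k n ↔ P.degree < n := by
  simp [lowDegree]

lemma card_lowDegree (n : ℕ) : (lowDegree k n).card = Fintype.card k ^ n := by
  have h : Finite (degreeLT k n) := Finite.of_equiv _ (degreeLTEquiv k n).symm.toEquiv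
  have h1 : ((lowDegree k n : Finset k[X]) : Set k[X]) = (degreeLT k n : Set k[X]) := by
    ext P; simp [mem_degreeLT]
  rw [← Set.ncard_coe_finset, h1]
  have h2 := Nat.card_congr (degreeLTEquiv k n).toEquiv
  rwa [Nat.card_eq_fintype_card (α := Fin n → k), Fintype.card_fun, Fintype.card_fin] at h2

variable (k) in
open scoped Classical in
/-- The monic irreducible polynomials of degree `d` over a finite field. -/
noncomputable def monicIrreducibles (d : ℕ) : Finset k[X] :=
  (lowDegree k (d + 1)).filter fun ℓ => ℓ.Monic ∧ Irreducible ℓ ∧ ℓ.natDegree = d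

lemma mem_monicIrreducibles {d : ℕ} {ℓ : k[X]} :
    ℓ ∈ monicIrreducibles k d ↔ ℓ.Monic ∧ Irreducible ℓ ∧ ℓ.natDegree = d := by
  simp only [monicIrreducibles, Finset.mem_filter, mem_lowDegree, and_iff_right_iff_imp]
  rintro ⟨-, h, rfl⟩
  rw [degree_eq_natDegree h.ne_zero]
  exact_mod_cast Nat.lt_succ_self _

lemma card_monicIrreducibles_le (d : ℕ) : (monicIrreducibles k d).card ≤ Fintype.card k ^ d := by
  rw [← card_lowDegree]
  refine Finset.card_le_card_of_injOn (fun ℓ => ℓ - X ^ d) (fun ℓ hℓ => ?_)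
    fun a _ b _ h => sub_left_injective h
  obtain ⟨h1, h2, h3⟩ := mem_monicIrreducibles.1 hℓ
  have h4 : ℓ.degree = d := by rw [degree_eq_natDegree h2.ne_zero, h3]
  simp only [Finset.mem_coe, mem_lowDegree]
  rw [← h4]
  exact degree_sub_lt_left (by simp [h4]) h2.ne_zero (by simp [h1.leadingCoeff])

open scoped Classical in
/-- The roots of `f` modulo `ℓ`, as reduced representatives. -/
noncomputable def residueRoots (f : k[X][X]) (ℓ : k[X]) : Finset k[X] :=
  (lowDegree k ℓ.natDegree).filter fun r => ℓ ∣ f.eval r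

lemma mem_residueRoots {f : k[X][X]} {ℓ r : k[X]} :
    r ∈ residueRoots f ℓ ↔ r.degree < ℓ.natDegree ∧ ℓ ∣ f.eval r := by
  simp [residueRoots]

variable {F : Type*} [Field F] [Algebra k F]

lemma aeval_pow_card_pow {d : ℕ} {t : F} (ht : t ^ Fintype.card k ^ d = t) (P : k[X]) :
    aeval t P ^ Fintype.card k ^ d = aeval t P := by
  have h : ∀ x : F, (FiniteField.frobeniusAlgHom k F ^ d) x = x ^ Fintype.card k ^ d := by
    intro x
    rw [AlgHom.coe_pow, FiniteField.coe_frobeniusAlgHom, pow_iterate]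
  rw [← h, ← aeval_algHom_apply, h, ht]

lemma minpoly_eq_of_mem_monicIrreducibles {d : ℕ} {ℓ : k[X]} (hℓ : ℓ ∈ monicIrreducibles k d)
    {t : F} (ht : aeval t ℓ = 0) : minpoly k t = ℓ := by
  obtain ⟨h1, h2, -⟩ := mem_monicIrreducibles.1 hℓ
  exact (minpoly.eq_of_irreducible_of_monic h2 ht h1).symm

lemma natDegree_minpoly_dvd_iff [Algebra.IsAlgebraic k F] {d : ℕ} {t : F} :
    (minpoly k t).natDegree ∣ d ↔ t ^ Fintype.card k ^ d = t := by
  have h_int : IsIntegral k t := Algebra.IsIntegral.isIntegral t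
  rw [(minpoly.irreducible h_int).natDegree_dvd_iff_dvd_X_pow_card_pow_sub_X, minpoly.dvd_iff,
    Nat.card_eq_fintype_card]
  simp [sub_eq_zero]

variable [IsAlgClosed F]

lemma card_powFixed_card_pow {d : ℕ} (hd : 0 < d) :
    (powFixed F (Fintype.card k ^ d)).card = Fintype.card k ^ d := by
  obtain ⟨p, hp⟩ := CharP.exists k
  have : CharP F p := (algebraMap k F).charP_iff (algebraMap k F).injective p |>.1 hp
  obtain ⟨n, hp', hn⟩ := FiniteField.card k p
  have : Fact p.Prime := ⟨hp'⟩
  rw [hn, ← pow_mul]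
  exact card_powFixed p (by positivity)

variable [Algebra.IsAlgebraic k F]

open scoped Classical in
lemma image_aeval_lowDegree {d : ℕ} {ℓ : k[X]} (hℓ : ℓ ∈ monicIrreducibles k d) {t : F}
    (ht : aeval t ℓ = 0) :
    Set.InjOn (fun r : k[X] => aeval t r) (lowDegree k d) ∧
      (lowDegree k d).image (fun r => aeval t r) = powFixed F (Fintype.card k ^ d) := by
  have hmin := minpoly_eq_of_mem_monicIrreducibles hℓ ht
  obtain ⟨h1, h2, h3⟩ := mem_monicIrreducibles.1 hℓ
  have hd : 0 < d := h3 ▸ h2.natDegree_pos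
  have hinj : Set.InjOn (fun r : k[X] => aeval t r) (lowDegree k d) := by
    intro a ha b hb hab
    simp only [Finset.mem_coe, mem_lowDegree] at ha hb
    have h4 : ℓ ∣ a - b := by
      rw [← hmin, minpoly.dvd_iff, map_sub]
      exact sub_eq_zero.2 hab
    have h5 : (a - b).degree < ℓ.degree := by
      rw [degree_eq_natDegree h2.ne_zero, h3]
      exact (degree_sub_le _ _).trans_lt (max_lt ha hb)
    exact sub_eq_zero.1 (eq_zero_of_dvd_of_degree_lt h4 h5)
  refine ⟨hinj, Finset.eq_of_subset_of_card_le ?_ ?_⟩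
  · intro x hx
    obtain ⟨r, -, rfl⟩ := Finset.mem_image.1 hx
    have h4 : t ^ Fintype.card k ^ d = t := by
      rw [← natDegree_minpoly_dvd_iff, hmin, h3]
    rw [mem_powFixed (Nat.one_lt_pow hd.ne' Fintype.one_lt_card)]
    exact aeval_pow_card_pow h4 r
  · rw [Finset.card_image_of_injOn hinj, card_lowDegree, card_powFixed_card_pow hd]

open scoped Classical in
lemma card_residueRoots {f : k[X][X]} (hf : 1 ≤ f.natDegree) {d : ℕ} {ℓ : k[X]}
    (hℓ : ℓ ∈ monicIrreducibles k d) (hlc : ¬ ℓ ∣ f.leadingCoeff) {t : F} (ht : aeval t ℓ = 0) :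
    (residueRoots f ℓ).card =
      ((f.integralNormalization.map (aeval t : k[X] →ₐ[k] F).toRingHom).roots.toFinset.filter
        fun x => x ^ Fintype.card k ^ d = x).card := by
  have hmin := minpoly_eq_of_mem_monicIrreducibles hℓ ht
  obtain ⟨h1, h2, h3⟩ := mem_monicIrreducibles.1 hℓ
  have hd : 0 < d := h3 ▸ h2.natDegree_pos
  obtain ⟨hinj, himage⟩ := image_aeval_lowDegree hℓ ht
  have hQ : 1 < Fintype.card k ^ d := Nat.one_lt_pow hd.ne' Fintype.one_lt_card
  have ht' : t ^ Fintype.card k ^ d = t := by rw [← natDegree_minpoly_dvd_iff, hmin, h3]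
  have hf0 : f ≠ 0 := by rintro rfl; simp at hf
  set φ := (aeval t : k[X] →ₐ[k] F).toRingHom
  have hφ : ∀ r, φ r = aeval t r := fun r => rfl
  have hc : φ f.leadingCoeff ≠ 0 := by
    rw [hφ, Ne, ← minpoly.dvd_iff, hmin]; exact hlc
  have hg0 : f.integralNormalization.map φ ≠ 0 := ((monic_integralNormalization hf0).map φ).ne_zero
  have key : ∀ r : k[X], ((f.integralNormalization.map φ).eval (φ f.leadingCoeff * φ r) = 0 ↔
      ℓ ∣ f.eval r) := by
    intro r
    rw [eval_map, integralNormalization_eval₂_leadingCoeff_mul hf, mul_eq_zero,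
      or_iff_right (pow_ne_zero _ hc), eval₂_at_apply, hφ, ← minpoly.dvd_iff, hmin]
  refine Finset.card_nbij (fun r => φ f.leadingCoeff * φ r) ?_ ?_ ?_
  · intro r hr
    simp only [residueRoots, Finset.coe_filter, Set.mem_ofPred_eq] at hr ⊢
    refine ⟨?_, ?_⟩
    · rw [Multiset.mem_toFinset, mem_roots hg0]
      exact (key r).2 hr.2
    · rw [← map_mul]
      exact aeval_pow_card_pow ht' _
  · intro a ha b hb hab
    simp only [residueRoots, Finset.coe_filter, Set.mem_ofPred_eq, h3] at ha hb
    exact hinj ha.1 hb.1 (mul_left_cancel₀ hc hab)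
  · intro y hy
    simp only [Finset.coe_filter, Set.mem_ofPred_eq, Multiset.mem_toFinset, mem_roots hg0] at hy
    have h4 : y / φ f.leadingCoeff ∈ powFixed F (Fintype.card k ^ d) := by
      rw [mem_powFixed hQ, div_pow, hy.2, hφ, aeval_pow_card_pow ht']
    rw [← himage] at h4
    obtain ⟨r, hr, hr'⟩ := Finset.mem_image.1 h4
    have h5 : φ f.leadingCoeff * φ r = y := by
      rw [hφ r, hr', mul_div_cancel₀ _ hc]
    refine ⟨r, ?_, h5⟩
    simp only [residueRoots, Finset.coe_filter, Set.mem_ofPred_eq, h3]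
    refine ⟨hr, (key r).1 ?_⟩
    rw [h5]
    exact hy.1

end FinitePolynomials

section AverageRootCount

variable {k : Type*} [Field k] [Fintype k] {F : Type*} [Field F] [Algebra k F] [IsAlgClosed F]
  [Algebra.IsAlgebraic k F]

open scoped Classical in
lemma card_filter_minpoly_eq {d : ℕ} {ℓ : k[X]} (hℓ : ℓ ∈ monicIrreducibles k d) :
    ((powFixed F (Fintype.card k ^ d)).filter fun t => minpoly k t = ℓ).card = d := by
  obtain ⟨h1, h2, h3⟩ := mem_monicIrreducibles.1 hℓ
  have hd : 0 < d := h3 ▸ h2.natDegree_pos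
  have hsep : (ℓ.map (algebraMap k F)).Separable :=
    (PerfectField.separable_of_irreducible h2).map
  have h4 : ((powFixed F (Fintype.card k ^ d)).filter fun t => minpoly k t = ℓ) =
      (ℓ.map (algebraMap k F)).roots.toFinset := by
    ext t
    rw [Finset.mem_filter, mem_powFixed (Nat.one_lt_pow hd.ne' Fintype.one_lt_card),
      Multiset.mem_toFinset, mem_roots hsep.ne_zero, IsRoot, eval_map_algebraMap]
    constructor
    · rintro ⟨-, rfl⟩
      exact minpoly.aeval k t
    · intro ht
      have hmin := minpoly_eq_of_mem_monicIrreducibles hℓ ht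
      exact ⟨by rw [← natDegree_minpoly_dvd_iff (k := k), hmin, h3], hmin⟩
  rw [h4, Multiset.toFinset_card_of_nodup (nodup_roots hsep), IsAlgClosed.card_roots_eq_natDegree,
    natDegree_map, h3]

open scoped Classical in
lemma card_filter_natDegree_minpoly_ne_le (d : ℕ) (hd : 0 < d) :
    ((powFixed F (Fintype.card k ^ d)).filter fun t => (minpoly k t).natDegree ≠ d).card ≤
      2 * Fintype.card k ^ (d / 2) := by
  have hq : 2 ≤ Fintype.card k := Fintype.one_lt_card
  have hsub : ((powFixed F (Fintype.card k ^ d)).filter fun t => (minpoly k t).natDegree ≠ d) ⊆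
      (Finset.Icc 1 (d / 2)).biUnion fun e => powFixed F (Fintype.card k ^ e) := by
    intro t ht
    rw [Finset.mem_filter, mem_powFixed (Nat.one_lt_pow hd.ne' Fintype.one_lt_card)] at ht
    obtain ⟨ht, hne⟩ := ht
    have hpos : 0 < (minpoly k t).natDegree :=
      minpoly.natDegree_pos (Algebra.IsIntegral.isIntegral t)
    obtain ⟨m, hm⟩ := natDegree_minpoly_dvd_iff.2 ht
    rw [Finset.mem_biUnion]
    refine ⟨_, Finset.mem_Icc.2 ⟨hpos, ?_⟩, ?_⟩
    · have : 2 ≤ m := by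
        rcases m with _ | _ | m
        · omega
        · omega
        · omega
      rw [Nat.le_div_iff_mul_le two_pos]
      calc _ ≤ (minpoly k t).natDegree * m := by gcongr
        _ = d := hm.symm
    · rw [mem_powFixed (Nat.one_lt_pow hpos.ne' Fintype.one_lt_card),
        ← natDegree_minpoly_dvd_iff (k := k)]
  have hgeom : ∀ m : ℕ, ∑ e ∈ Finset.Icc 1 m, Fintype.card k ^ e + 2 ≤ 2 * Fintype.card k ^ m := by
    intro m
    induction m with
    | zero => simp
    | succ m ih =>
      rw [Finset.sum_Icc_succ_top (by omega), pow_succ]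
      nlinarith [Nat.zero_le (Fintype.card k ^ m)]
  calc _ ≤ _ := Finset.card_le_card hsub
    _ ≤ ∑ e ∈ Finset.Icc 1 (d / 2), (powFixed F (Fintype.card k ^ e)).card := Finset.card_biUnion_le
    _ = ∑ e ∈ Finset.Icc 1 (d / 2), Fintype.card k ^ e :=
      Finset.sum_congr rfl fun e he => card_powFixed_card_pow (Finset.mem_Icc.1 he).1
    _ ≤ _ := (Nat.le_add_right _ 2).trans (hgeom _)

lemma exists_abs_sum_sub_curvePointCount_le {f : k[X][X]} (hf : 1 ≤ f.natDegree) :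
    ∃ d₀ : ℕ, ∀ d, d₀ ≤ d →
      |(∑ ℓ ∈ monicIrreducibles k d, (d : ℤ) * (1 - (residueRoots f ℓ).card)) -
        ((Fintype.card k ^ d : ℕ) - (curvePointCount (f.integralNormalization.map
          (mapRingHom (algebraMap k F))) (Fintype.card k ^ d) : ℤ))| ≤
        (2 * f.natDegree) * Fintype.card k ^ (d / 2) := by
  classical
  have hf0 : f ≠ 0 := by rintro rfl; simp at hf
  refine ⟨f.leadingCoeff.natDegree + 1, fun d hd => ?_⟩
  have hd0 : 0 < d := by omega
  set Q := Fintype.card k ^ d with hQ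
  set g := f.integralNormalization.map (mapRingHom (algebraMap k F)) with hg
  have hgt : ∀ t : F, g.map (evalRingHom t) =
      f.integralNormalization.map (aeval t : k[X] →ₐ[k] F).toRingHom := by
    intro t
    rw [hg, Polynomial.map_map]
    congr 1
    ext <;> simp
  set c : F → ℤ := fun t => 1 -
    (((g.map (evalRingHom t)).roots.toFinset.filter fun x => x ^ Q = x).card : ℤ) with hc
  have hcle : ∀ t, |c t| ≤ f.natDegree := by
    intro t
    have h1 : ((g.map (evalRingHom t)).roots.toFinset.filter fun x => x ^ Q = x).card ≤
        f.natDegree := by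
      refine (Finset.card_filter_le _ _).trans ((Multiset.toFinset_card_le _).trans
        ((card_roots' _).trans ?_))
      rw [hgt]
      exact natDegree_map_le.trans natDegree_integralNormalization.le
    rw [hc, abs_le]
    constructor <;> push_cast <;> omega
  have h1 : ((Q : ℕ) - (curvePointCount g Q : ℤ)) = ∑ t ∈ powFixed F Q, c t := by
    rw [hc, Finset.sum_sub_distrib, curvePointCount]
    simp [card_powFixed_card_pow (k := k) (F := F) hd0, hQ]
  have h2 : ∑ ℓ ∈ monicIrreducibles k d, (d : ℤ) * (1 - (residueRoots f ℓ).card) =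
      ∑ t ∈ (powFixed F Q).filter (fun t => (minpoly k t).natDegree = d), c t := by
    rw [← Finset.sum_fiberwise_of_maps_to (s := (powFixed F Q).filter
      (fun t => (minpoly k t).natDegree = d)) (t := monicIrreducibles k d) (g := minpoly k)]
    · refine Finset.sum_congr rfl fun ℓ hℓ => ?_
      have h3 : ((powFixed F Q).filter fun t => (minpoly k t).natDegree = d).filter
          (fun t => minpoly k t = ℓ) = (powFixed F Q).filter fun t => minpoly k t = ℓ := by
        rw [Finset.filter_filter]
        refine Finset.filter_congr fun t _ => ⟨fun h => h.2, fun h => ⟨?_, h⟩⟩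
        rw [h]; exact (mem_monicIrreducibles.1 hℓ).2.2
      rw [h3, ← nsmul_eq_mul]
      nth_rewrite 1 [← card_filter_minpoly_eq (F := F) hℓ]
      rw [← Finset.sum_const]
      refine Finset.sum_congr rfl fun t ht => ?_
      have ht' : aeval t ℓ = 0 := by
        rw [← (Finset.mem_filter.1 ht).2]; exact minpoly.aeval k t
      have hlc : ¬ ℓ ∣ f.leadingCoeff := by
        intro h
        have := natDegree_le_of_dvd h (by simpa using hf0)
        rw [(mem_monicIrreducibles.1 hℓ).2.2] at this
        omega
      rw [hc, card_residueRoots hf hℓ hlc ht', ← hgt]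
    · intro t ht
      exact mem_monicIrreducibles.2 ⟨minpoly.monic (Algebra.IsIntegral.isIntegral t),
        minpoly.irreducible (Algebra.IsIntegral.isIntegral t), (Finset.mem_filter.1 ht).2⟩
  rw [h1, h2, ← Finset.sum_filter_add_sum_filter_not (powFixed F Q)
    (fun t => (minpoly k t).natDegree = d), sub_add_cancel_left, abs_neg]
  calc _ ≤ ∑ t ∈ (powFixed F Q).filter fun t => ¬ (minpoly k t).natDegree = d, |c t| :=
        Finset.abs_sum_le_sum_abs _ _
    _ ≤ _ := Finset.sum_le_card_nsmul _ _ _ fun t _ => hcle t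
    _ ≤ (2 * Fintype.card k ^ (d / 2) : ℕ) * (f.natDegree : ℤ) := by
        rw [nsmul_eq_mul]
        gcongr
        exact card_filter_natDegree_minpoly_ne_le d hd0
    _ = _ := by push_cast; ring

/-- The number of roots of an absolutely irreducible `f` modulo a prime of degree `d` is `1` on
average, with a power saving error term. -/
theorem exists_abs_sum_residueRoots_le {f : k[X][X]} (hf : 1 ≤ f.natDegree)
    (hsep : derivative f ≠ 0) (habs : Irreducible (f.map (mapRingHom (algebraMap k F)))) :
    ∃ C d₀ : ℕ, ∀ d, d₀ ≤ d →
      |∑ ℓ ∈ monicIrreducibles k d, (d : ℤ) * (1 - (residueRoots f ℓ).card)| ≤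
        C * Fintype.card k ^ (d - d / 2) := by
  have hf0 : f ≠ 0 := by rintro rfl; simp at hf
  obtain ⟨p, hp⟩ := CharP.exists k
  have : CharP F p := (algebraMap k F).charP_iff (algebraMap k F).injective p |>.1 hp
  obtain ⟨s, hp', hs⟩ := FiniteField.card k p
  have : Fact p.Prime := ⟨hp'⟩
  have hinj : Function.Injective (mapRingHom (algebraMap k F)) :=
    map_injective _ (algebraMap k F).injective
  set fF := f.map (mapRingHom (algebraMap k F)) with hfF
  have hnat : fF.natDegree = f.natDegree := natDegree_map_eq_of_injective hinj f
  set g := f.integralNormalization.map (mapRingHom (algebraMap k F)) with hg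
  have hgf : g = fF.integralNormalization := by
    rw [hg, hfF, integralNormalization_map]
    rw [Ne, map_eq_zero_iff _ hinj]
    simpa using hf0
  have hmon : g.Monic := (monic_integralNormalization hf0).map _
  have hirr : Irreducible g := hgf ▸ irreducible_integralNormalization habs (hnat ▸ hf)
  have hdeg : g.natDegree = f.natDegree := by
    rw [hgf, natDegree_integralNormalization, hnat]
  have hder : derivative g ≠ 0 := by
    rw [hgf]
    refine derivative_integralNormalization_ne_zero (hnat ▸ hf) ?_
    rw [hfF, derivative_map]
    exact (Polynomial.map_ne_zero_iff hinj).2 hsep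
  have hfrob : g.map (mapRingHom (iterateFrobenius F p s)) = g := by
    rw [hg, Polynomial.map_map]
    congr 1
    ext a
    · simp [iterateFrobenius_def, ← map_pow, ← hs, FiniteField.pow_card]
    · simp
  obtain ⟨u, v, D, hD, huv⟩ := exists_mul_add_mul_eq_C (K := FractionRing F[X]) (f := g)
    (g := derivative g) (by
      rw [← derivative_map]
      have h := (hmon.irreducible_iff_irreducible_map_fraction_map (K := FractionRing F[X])).1 hirr
      refine (separable_iff_derivative_ne_zero h).2 ?_
      rw [derivative_map]
      exact (Polynomial.map_ne_zero_iff (IsFractionRing.injective _ _)).2 hder)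
  obtain ⟨C, d₁, hC⟩ := exists_abs_curvePointCount_sub_le p s.pos hmon (by omega) hirr hfrob hD huv
  obtain ⟨d₂, h2⟩ := exists_abs_sum_sub_curvePointCount_le (F := F) hf
  refine ⟨C + 2 * f.natDegree, max d₁ d₂, fun d hd => ?_⟩
  have h3 := hC d (le_of_max_le_left hd)
  have h4 := h2 d (le_of_max_le_right hd)
  have h5 : (p : ℤ) ^ (s : ℕ) = Fintype.card k := by rw [hs]; push_cast; rfl
  rw [← hg] at h4
  rw [← hs, h5] at h3
  have h6 : (Fintype.card k : ℤ) ^ (d / 2) ≤ Fintype.card k ^ (d - d / 2) :=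
    pow_le_pow_right₀ (by exact_mod_cast Fintype.card_pos) (by omega)
  have h7 : (2 * f.natDegree : ℤ) * Fintype.card k ^ (d / 2) ≤
    (2 * f.natDegree) * Fintype.card k ^ (d - d / 2) := by gcongr
  push_cast at h3 h4 ⊢
  rw [abs_le] at h3 h4 ⊢
  constructor <;> linarith

end AverageRootCount

section Homogenization

variable {k : Type*} [Field k]

lemma degree_mul_lt_iff {g a : k[X]} (hg : g.Monic) {M : ℕ} (h : g.natDegree ≤ M) :
    (g * a).degree < (M : ℕ) ↔ a.degree < (M - g.natDegree : ℕ) := by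
  rcases eq_or_ne a 0 with rfl | ha
  · simp [bot_lt_iff_ne_bot]
  · rw [degree_mul, degree_eq_natDegree hg.ne_zero, degree_eq_natDegree ha]
    norm_cast
    omega

/-- The homogenization of `f` as a polynomial in its first argument. -/
noncomputable def homogPoly (f : k[X][X]) (b : k[X]) : k[X][X] :=
  ∑ i ∈ Finset.range (f.natDegree + 1), C (f.coeff i * b ^ (f.natDegree - i)) * X ^ i

lemma eval_homogPoly (f : k[X][X]) (a b : k[X]) : (homogPoly f b).eval a = homogEval f a b := by
  rw [homogPoly, homogEval, eval_finsetSum]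
  exact Finset.sum_congr rfl fun i _ => by simp only [eval_mul, eval_C, eval_pow, eval_X]; ring

lemma coeff_homogPoly_natDegree (f : k[X][X]) (b : k[X]) :
    (homogPoly f b).coeff f.natDegree = f.leadingCoeff := by
  rw [homogPoly, finsetSum_coeff]
  simp only [coeff_C_mul, coeff_X_pow]
  simp

lemma natDegree_homogPoly_le (f : k[X][X]) (b : k[X]) : (homogPoly f b).natDegree ≤ f.natDegree :=
  natDegree_sum_le_of_forall_le _ _ fun _ hi =>
    (natDegree_C_mul_X_pow_le _ _).trans (Nat.lt_succ_iff.1 (Finset.mem_range.1 hi))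

lemma homogEval_mul_mul (f : k[X][X]) (g a b : k[X]) :
    homogEval f (g * a) (g * b) = g ^ f.natDegree * homogEval f a b := by
  rw [homogEval, homogEval, Finset.mul_sum]
  refine Finset.sum_congr rfl fun i hi => ?_
  have h : g ^ f.natDegree = g ^ i * g ^ (f.natDegree - i) := by
    rw [← pow_add]; congr 1; have := Finset.mem_range.1 hi; omega
  rw [h]; ring

lemma homogEval_mul_self (f : k[X][X]) (s b : k[X]) :
    homogEval f (s * b) b = b ^ f.natDegree * f.eval s := by
  have h := homogEval_mul_mul f b s 1
  rw [mul_one, mul_comm b s] at h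
  rw [h, homogEval, eval_eq_sum_range]
  simp

lemma dvd_homogEval_iff {f : k[X][X]} {m a b s : k[X]} (hb : IsCoprime m b) (h : m ∣ a - s * b) :
    m ∣ homogEval f a b ↔ m ∣ f.eval s := by
  have h1 : m ∣ homogEval f a b - homogEval f (s * b) b := by
    rw [← eval_homogPoly, ← eval_homogPoly]
    exact h.trans (sub_dvd_eval_sub _ _ _)
  rw [dvd_iff_dvd_of_dvd_sub h1, homogEval_mul_self]
  have h2 : IsCoprime m (b ^ f.natDegree) := hb.pow_right
  exact ⟨h2.dvd_of_dvd_mul_left, fun h3 => h3.mul_left _⟩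

end Homogenization

section Counting

variable {k : Type*} [Field k] [Fintype k]

open scoped Classical in
lemma card_filter_dvd_sub {m : k[X]} (hm : m.Monic) {M : ℕ} (h : m.natDegree ≤ M) (c : k[X]) :
    ((lowDegree k M).filter fun P => m ∣ P - c).card = Fintype.card k ^ (M - m.natDegree) := by
  rw [← card_lowDegree]
  have hlt : (c %ₘ m).degree < (M : ℕ) := (degree_modByMonic_lt c hm).trans_le
    (by rw [degree_eq_natDegree hm.ne_zero]; exact_mod_cast h)
  symm
  refine Finset.card_nbij (fun P => m * P + c %ₘ m) ?_ ?_ ?_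
  · intro P hP
    rw [Finset.mem_coe, mem_lowDegree] at hP
    rw [Finset.mem_coe, Finset.mem_filter, mem_lowDegree]
    refine ⟨(degree_add_le _ _).trans_lt (max_lt ((degree_mul_lt_iff hm h).2 hP) hlt), ?_⟩
    refine ⟨P - c /ₘ m, ?_⟩
    conv_lhs => rw [← modByMonic_add_div c m]
    rw [modByMonic_add_div]
    linear_combination modByMonic_add_div c m
  · intro P _ P' _ h
    exact mul_left_cancel₀ hm.ne_zero (add_right_cancel h)
  · intro P hP
    simp only [Finset.coe_filter, mem_lowDegree, Set.mem_ofPred_eq] at hP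
    have h1 : P %ₘ m = c %ₘ m := by
      rw [← sub_eq_zero, ← sub_modByMonic, (modByMonic_eq_zero_iff_dvd hm)]
      exact hP.2
    refine ⟨P /ₘ m, ?_, ?_⟩
    · rw [Finset.mem_coe, mem_lowDegree, ← degree_mul_lt_iff hm h]
      rw [eq_sub_iff_add_eq'.2 (modByMonic_add_div P m), h1]
      exact (degree_sub_le _ _).trans_lt (max_lt hP.1 hlt)
    · simp only
      rw [← h1, add_comm, modByMonic_add_div]

open scoped Classical in
lemma card_filter_dvd_sub_le {m : k[X]} (hm : m.Monic) (M : ℕ) (c : k[X]) :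
    (((lowDegree k M).filter fun P => m ∣ P - c).card : ℝ) ≤
      (Fintype.card k : ℝ) ^ M / (Fintype.card k : ℝ) ^ m.natDegree + 1 := by
  have hq : (0 : ℝ) < Fintype.card k := by exact_mod_cast Fintype.card_pos
  rcases le_or_gt m.natDegree M with h | h
  · rw [card_filter_dvd_sub hm h, Nat.cast_pow, pow_sub₀ _ hq.ne' h, div_eq_mul_inv]
    linarith
  · have h1 : ((lowDegree k M).filter fun P => m ∣ P - c).card ≤ 1 := by
      refine Finset.card_le_one.2 fun a ha b hb => ?_
      rw [Finset.mem_filter, mem_lowDegree] at ha hb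
      have h2 : m ∣ a - b := by
        have := dvd_sub ha.2 hb.2
        rwa [sub_sub_sub_cancel_right] at this
      refine sub_eq_zero.1 (eq_zero_of_dvd_of_degree_lt h2 ?_)
      refine (degree_sub_le _ _).trans_lt ((max_lt ha.1 hb.1).trans ?_)
      rw [degree_eq_natDegree hm.ne_zero]
      exact_mod_cast h
    have h3 : (((lowDegree k M).filter fun P => m ∣ P - c).card : ℝ) ≤ 1 := by exact_mod_cast h1
    have : 0 ≤ (Fintype.card k : ℝ) ^ M / (Fintype.card k : ℝ) ^ m.natDegree := by positivity
    linarith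

open scoped Classical in
lemma filter_dvd_homogEval_eq_biUnion (f : k[X][X]) {m : k[X]} (hm : m.Monic) {b : k[X]}
    (hb : IsCoprime m b) (M : ℕ) :
    ((lowDegree k M).filter fun a => m ∣ homogEval f a b) =
      (residueRoots f m).biUnion fun s => (lowDegree k M).filter fun a => m ∣ a - s * b := by
  ext a
  simp only [Finset.mem_filter, Finset.mem_biUnion, mem_residueRoots]
  constructor
  · rintro ⟨h1, h2⟩
    obtain ⟨u, v, huv⟩ := hb
    have h3 : m ∣ a - ((a * v) %ₘ m) * b := by
      refine ⟨a * u + (a * v) /ₘ m * b, ?_⟩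
      linear_combination (-b) * modByMonic_add_div (a * v) m - a * huv
    refine ⟨(a * v) %ₘ m, ⟨?_, (dvd_homogEval_iff ⟨u, v, huv⟩ h3).1 h2⟩, h1, h3⟩
    rw [← degree_eq_natDegree hm.ne_zero]
    exact degree_modByMonic_lt _ hm
  · rintro ⟨s, ⟨-, hs⟩, h1, h2⟩
    exact ⟨h1, (dvd_homogEval_iff hb h2).2 hs⟩

open scoped Classical in
lemma card_filter_dvd_homogEval_eq_sum (f : k[X][X]) {m : k[X]} (hm : m.Monic) {b : k[X]}
    (hb : IsCoprime m b) (M : ℕ) :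
    ((lowDegree k M).filter fun a => m ∣ homogEval f a b).card =
      ∑ s ∈ residueRoots f m, ((lowDegree k M).filter fun a => m ∣ a - s * b).card := by
  rw [filter_dvd_homogEval_eq_biUnion f hm hb, Finset.card_biUnion]
  intro s hs s' hs' hne
  refine Finset.disjoint_left.2 fun a ha ha' => ?_
  rw [Finset.mem_filter] at ha ha'
  rw [Finset.mem_coe, mem_residueRoots] at hs hs'
  apply hne
  have h1 : m ∣ (s' - s) * b := by
    have := dvd_sub ha.2 ha'.2
    rwa [sub_sub_sub_cancel_left, ← sub_mul] at this
  have h2 := hb.dvd_of_dvd_mul_right h1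
  refine (sub_eq_zero.1 (eq_zero_of_dvd_of_degree_lt h2 ?_)).symm
  rw [degree_eq_natDegree hm.ne_zero]
  exact (degree_sub_le _ _).trans_lt (max_lt hs'.1 hs.1)

open scoped Classical in
lemma card_filter_dvd_homogEval (f : k[X][X]) {m : k[X]} (hm : m.Monic) {b : k[X]}
    (hb : IsCoprime m b) {M : ℕ} (hM : m.natDegree ≤ M) :
    ((lowDegree k M).filter fun a => m ∣ homogEval f a b).card =
      (residueRoots f m).card * Fintype.card k ^ (M - m.natDegree) := by
  rw [card_filter_dvd_homogEval_eq_sum f hm hb,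
    Finset.sum_congr rfl fun s _ => card_filter_dvd_sub hm hM _, Finset.sum_const, smul_eq_mul]

open scoped Classical in
lemma card_filter_dvd_homogEval_le (f : k[X][X]) {m : k[X]} (hm : m.Monic) {b : k[X]}
    (hb : IsCoprime m b) (M : ℕ) :
    (((lowDegree k M).filter fun a => m ∣ homogEval f a b).card : ℝ) ≤
      (residueRoots f m).card *
        ((Fintype.card k : ℝ) ^ M / (Fintype.card k : ℝ) ^ m.natDegree + 1) := by
  rw [card_filter_dvd_homogEval_eq_sum f hm hb, Nat.cast_sum, ← nsmul_eq_mul]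
  exact Finset.sum_le_card_nsmul _ _ _ fun s _ => card_filter_dvd_sub_le hm _ _

open scoped Classical in
lemma card_filter_homogEval_eq_zero_le {f : k[X][X]} (hf : f ≠ 0) (b : k[X]) (M : ℕ) :
    ((lowDegree k M).filter fun a => homogEval f a b = 0).card ≤ f.natDegree := by
  have h0 : homogPoly f b ≠ 0 := by
    intro h
    have := coeff_homogPoly_natDegree f b
    rw [h, coeff_zero, eq_comm, leadingCoeff_eq_zero] at this
    exact hf this
  refine le_trans (Finset.card_le_card ?_) ((Multiset.toFinset_card_le _).trans
    ((card_roots' (homogPoly f b)).trans (natDegree_homogPoly_le f b)))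
  intro a ha
  rw [Multiset.mem_toFinset, mem_roots h0, IsRoot, eval_homogPoly]
  exact (Finset.mem_filter.1 ha).2

lemma card_residueRoots_le_natDegree {f : k[X][X]} (hf : 1 ≤ f.natDegree) {ℓ : k[X]}
    (hℓ : ℓ.Monic) (hirr : Irreducible ℓ) (hlc : ¬ ℓ ∣ f.leadingCoeff) :
    (residueRoots f ℓ).card ≤ f.natDegree := by
  classical
  obtain ⟨t, ht⟩ := IsAlgClosed.exists_aeval_eq_zero (AlgebraicClosure k) ℓ
    (degree_pos_of_irreducible hirr).ne'
  rw [card_residueRoots hf (mem_monicIrreducibles.2 ⟨hℓ, hirr, rfl⟩) hlc ht]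
  exact (Finset.card_filter_le _ _).trans ((Multiset.toFinset_card_le _).trans
    ((card_roots' _).trans (natDegree_map_le.trans natDegree_integralNormalization.le)))

lemma card_residueRoots_pow_le {f u v : k[X][X]} {D ℓ : k[X]} (hℓ : ℓ.Monic) (hirr : Irreducible ℓ)
    (huv : u * f + v * derivative f = C D) (hD : ¬ ℓ ∣ D) {j : ℕ} (hj : j ≠ 0) :
    (residueRoots f (ℓ ^ j)).card ≤ (residueRoots f ℓ).card := by
  refine Finset.card_le_card_of_injOn (fun s => s %ₘ ℓ) ?_ ?_
  · intro s hs
    rw [Finset.mem_coe, mem_residueRoots] at hs ⊢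
    rw [← degree_eq_natDegree hℓ.ne_zero]
    refine ⟨degree_modByMonic_lt _ hℓ, ?_⟩
    have h1 : ℓ ∣ f.eval (s %ₘ ℓ) - f.eval s := by
      refine dvd_trans ?_ (sub_dvd_eval_sub _ _ _)
      exact ⟨-(s /ₘ ℓ), by linear_combination modByMonic_add_div s ℓ⟩
    rw [dvd_iff_dvd_of_dvd_sub h1]
    exact (dvd_pow_self ℓ hj).trans hs.2
  · intro s hs s' hs' h
    rw [Finset.mem_coe, mem_residueRoots] at hs hs'
    simp only at h
    obtain ⟨z, hz⟩ := f.binomExpansion s' (s - s')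
    rw [add_sub_cancel] at hz
    have h1 : ℓ ∣ s - s' := by
      rw [← modByMonic_eq_zero_iff_dvd hℓ, sub_modByMonic, h, sub_self]
    have h2 : ℓ ∣ f.eval s' := (dvd_pow_self ℓ hj).trans hs'.2
    have h3 : ¬ ℓ ∣ f.derivative.eval s' := by
      intro h3
      apply hD
      have h4 := congrArg (eval s') huv
      rw [eval_add, eval_mul, eval_mul, eval_C] at h4
      rw [← h4]
      exact dvd_add (h2.mul_left _) (h3.mul_left _)
    have h4 : ¬ ℓ ∣ f.derivative.eval s' + z * (s - s') := by
      rwa [dvd_add_left (h1.mul_left _)]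
    have h5 : IsCoprime (ℓ ^ j) (f.derivative.eval s' + z * (s - s')) :=
      IsCoprime.pow_left ((hirr.coprime_iff_not_dvd).2 h4)
    have h6 : ℓ ^ j ∣ (s - s') * (f.derivative.eval s' + z * (s - s')) := by
      have h7 := dvd_sub hs.2 hs'.2
      rw [hz] at h7
      convert h7 using 1
      ring
    have h7 := h5.dvd_of_dvd_mul_right h6
    refine sub_eq_zero.1 (eq_zero_of_dvd_of_degree_lt h7 ?_)
    rw [degree_eq_natDegree (hℓ.pow j).ne_zero]
    exact (degree_sub_le _ _).trans_lt (max_lt hs.1 hs'.1)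

end Counting

lemma exists_monic_mul_isCoprime {k : Type*} [Field k] {a b : k[X]} (h : a ≠ 0 ∨ b ≠ 0) :
    ∃ g a' b' : k[X], g.Monic ∧ IsCoprime a' b' ∧ a = g * a' ∧ b = g * b' := by
  classical
  set d := EuclideanDomain.gcd a b
  have hd : d ≠ 0 := by
    intro h0
    rcases EuclideanDomain.gcd_eq_zero_iff.1 h0 with ⟨rfl, rfl⟩
    simp at h
  have hlc : d.leadingCoeff ≠ 0 := leadingCoeff_ne_zero.2 hd
  obtain ⟨a', ha⟩ := EuclideanDomain.gcd_dvd_left a b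
  obtain ⟨b', hb⟩ := EuclideanDomain.gcd_dvd_right a b
  refine ⟨d * C d.leadingCoeff⁻¹, C d.leadingCoeff * a', C d.leadingCoeff * b',
    monic_mul_leadingCoeff_inv hd, ?_, ?_, ?_⟩
  · have h1 := EuclideanDomain.gcd_eq_gcd_ab a b
    have h2 : IsCoprime a' b' := by
      refine ⟨EuclideanDomain.gcdA a b, EuclideanDomain.gcdB a b, mul_left_cancel₀ hd ?_⟩
      linear_combination (-EuclideanDomain.gcdA a b) * ha - EuclideanDomain.gcdB a b * hb - h1
    have hu : IsUnit (C d.leadingCoeff) := isUnit_C.2 hlc.isUnit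
    exact (isCoprime_mul_unit_left hu a' b').2 h2
  · rw [mul_assoc, ← mul_assoc (C _) (C _), ← C_mul, inv_mul_cancel₀ hlc, C_1, one_mul]
    exact ha
  · rw [mul_assoc, ← mul_assoc (C _) (C _), ← C_mul, inv_mul_cancel₀ hlc, C_1, one_mul]
    exact hb

section CoprimePairs

variable {k : Type*} [Field k] [Fintype k]

variable (k) in
open scoped Classical in
/-- The monic polynomials of degree `m` over a finite field. -/
noncomputable def monicsOfDegree (m : ℕ) : Finset k[X] := (lowDegree k m).image fun P => X ^ m + P

lemma card_monicsOfDegree (m : ℕ) : (monicsOfDegree k m).card = Fintype.card k ^ m := by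
  classical
  rw [monicsOfDegree, Finset.card_image_of_injective _ (add_right_injective _), card_lowDegree]

lemma mem_monicsOfDegree {m : ℕ} {g : k[X]} :
    g ∈ monicsOfDegree k m ↔ g.Monic ∧ g.natDegree = m := by
  simp only [monicsOfDegree, Finset.mem_image, mem_lowDegree]
  constructor
  · rintro ⟨P, hP, rfl⟩
    exact ⟨monic_X_pow_add hP, natDegree_eq_of_degree_eq_some (by
      rw [degree_add_eq_left_of_degree_lt (by rwa [degree_X_pow]), degree_X_pow])⟩
  · rintro ⟨h, rfl⟩
    refine ⟨g - X ^ g.natDegree, ?_, add_sub_cancel _ _⟩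
    have h4 : g.degree = g.natDegree := degree_eq_natDegree h.ne_zero
    rw [← h4]
    exact degree_sub_lt_left (by simp [h4]) h.ne_zero (by simp [h.leadingCoeff])

open scoped Classical in
/-- The coprime pairs of polynomials of degree at most `N` satisfying `p`. -/
noncomputable def coprimePairs (p : k[X] × k[X] → Prop) (N : ℕ) : Finset (k[X] × k[X]) :=
  (lowDegree k (N + 1) ×ˢ lowDegree k (N + 1)).filter fun P => IsCoprime P.1 P.2 ∧ p P

lemma mem_coprimePairs {p : k[X] × k[X] → Prop} {N : ℕ} {P : k[X] × k[X]} :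
    P ∈ coprimePairs p N ↔ (P.1.degree < (N + 1 : ℕ) ∧ P.2.degree < (N + 1 : ℕ)) ∧
      IsCoprime P.1 P.2 ∧ p P := by
  simp [coprimePairs]

open scoped Classical in
/-- The nonzero pairs of polynomials of degree at most `N` whose primitive part satisfies `p`. -/
noncomputable def scaledPairs (p : k[X] × k[X] → Prop) (N : ℕ) : Finset (k[X] × k[X]) :=
  (lowDegree k (N + 1) ×ˢ lowDegree k (N + 1)).filter fun P => ∃ (g : k[X]) (P' : k[X] × k[X]),
    g.Monic ∧ IsCoprime P'.1 P'.2 ∧ p P' ∧ P = (g * P'.1, g * P'.2)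

lemma mem_scaledPairs {p : k[X] × k[X] → Prop} {N : ℕ} {P : k[X] × k[X]} :
    P ∈ scaledPairs p N ↔ (P.1.degree < (N + 1 : ℕ) ∧ P.2.degree < (N + 1 : ℕ)) ∧
      ∃ (g : k[X]) (P' : k[X] × k[X]),
        g.Monic ∧ IsCoprime P'.1 P'.2 ∧ p P' ∧ P = (g * P'.1, g * P'.2) := by
  simp [scaledPairs]

lemma card_scaledPairs (p : k[X] × k[X] → Prop) (N : ℕ) :
    (scaledPairs p N).card =
      ∑ m ∈ Finset.range (N + 1), Fintype.card k ^ m * (coprimePairs p (N - m)).card := by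
  have h1 : ∀ m, Fintype.card k ^ m * (coprimePairs p (N - m)).card =
      (monicsOfDegree k m ×ˢ coprimePairs p (N - m)).card := by
    intro m; rw [Finset.card_product, card_monicsOfDegree]
  rw [Finset.sum_congr rfl fun m _ => h1 m, ← Finset.card_sigma]
  symm
  refine Finset.card_nbij (fun z => (z.2.1 * z.2.2.1, z.2.1 * z.2.2.2)) ?_ ?_ ?_
  · rintro ⟨m, g, P⟩ hz
    simp only [Finset.mem_coe, Finset.mem_sigma, Finset.mem_range, Finset.mem_product,
      mem_monicsOfDegree, mem_coprimePairs, mem_scaledPairs] at hz ⊢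
    obtain ⟨hm, ⟨hg, rfl⟩, ⟨hP1, hP2⟩, hP, hp⟩ := hz
    have hle : g.natDegree ≤ N + 1 := hm.le
    have he : N - g.natDegree + 1 = N + 1 - g.natDegree := by omega
    rw [degree_mul_lt_iff hg hle, degree_mul_lt_iff hg hle, ← he]
    exact ⟨⟨hP1, hP2⟩, g, P, hg, hP, hp, rfl⟩
  · rintro ⟨m, g, a, b⟩ hz ⟨m', g', a', b'⟩ hz' h
    simp only [Finset.mem_coe, Finset.mem_sigma, Finset.mem_range, Finset.mem_product,
      mem_monicsOfDegree, mem_coprimePairs, Prod.mk.injEq] at hz hz' h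
    obtain ⟨-, ⟨hg, rfl⟩, -, ⟨u, v, huv⟩, -⟩ := hz
    obtain ⟨-, ⟨hg', rfl⟩, -, ⟨u', v', huv'⟩, -⟩ := hz'
    have h2 : g = g' := by
      refine eq_of_monic_of_associated hg hg' (associated_of_dvd_dvd ?_ ?_)
      · exact ⟨u' * a + v' * b, by linear_combination (-g') * huv' - u' * h.1 - v' * h.2⟩
      · exact ⟨u * a' + v * b', by linear_combination (-g) * huv + u * h.1 + v * h.2⟩
    subst h2
    rw [mul_left_cancel₀ hg.ne_zero h.1, mul_left_cancel₀ hg.ne_zero h.2]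
  · rintro ⟨a, b⟩ hP
    rw [Finset.mem_coe, mem_scaledPairs] at hP
    obtain ⟨⟨h1, h2⟩, g, ⟨a', b'⟩, hg, hc, hp, h⟩ := hP
    simp only [Prod.mk.injEq] at h hc
    obtain ⟨rfl, rfl⟩ := h
    have hle : g.natDegree ≤ N := by
      have key : ∀ c : k[X], c ≠ 0 → (g * c).degree < (N + 1 : ℕ) → g.natDegree ≤ N := by
        intro c hc hlt
        rw [degree_mul, degree_eq_natDegree hg.ne_zero, degree_eq_natDegree hc] at hlt
        norm_cast at hlt
        omega
      by_cases ha : a' = 0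
      · refine key b' ?_ h2
        rintro rfl
        rw [ha] at hc
        exact not_isCoprime_zero_zero hc
      · exact key a' ha h1
    refine ⟨⟨g.natDegree, g, a', b'⟩, ?_, rfl⟩
    simp only [Finset.mem_coe, Finset.mem_sigma, Finset.mem_range, Finset.mem_product,
      mem_monicsOfDegree, mem_coprimePairs]
    have hle' : g.natDegree ≤ N + 1 := by omega
    have he : N - g.natDegree + 1 = N + 1 - g.natDegree := by omega
    rw [degree_mul_lt_iff hg hle'] at h1 h2
    rw [he]
    exact ⟨by omega, ⟨hg, trivial⟩, ⟨h1, h2⟩, hc, hp⟩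

lemma card_scaledPairs_succ (p : k[X] × k[X] → Prop) (N : ℕ) :
    (scaledPairs p (N + 1)).card =
      (coprimePairs p (N + 1)).card + Fintype.card k * (scaledPairs p N).card := by
  rw [card_scaledPairs, Finset.sum_range_succ', card_scaledPairs, add_comm, Finset.mul_sum]
  congr 1
  · simp
  · refine Finset.sum_congr rfl fun m _ => ?_
    rw [Nat.add_sub_add_right, pow_succ]; ring

lemma card_scaledPairs_true (N : ℕ) :
    (scaledPairs (fun _ : k[X] × k[X] => True) N).card + 1 = (Fintype.card k ^ (N + 1)) ^ 2 := by
  classical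
  have h1 : scaledPairs (fun _ : k[X] × k[X] => True) N =
      (lowDegree k (N + 1) ×ˢ lowDegree k (N + 1)).erase 0 := by
    ext ⟨a, b⟩
    simp only [mem_scaledPairs, Finset.mem_erase, Finset.mem_product, mem_lowDegree]
    rw [and_comm, and_congr_left_iff]
    rintro -
    constructor
    · rintro ⟨g, ⟨a', b'⟩, hg, hc, -, h⟩ h0
      have h1 : g * a' = 0 := congrArg Prod.fst (h.symm.trans h0)
      have h2 : g * b' = 0 := congrArg Prod.snd (h.symm.trans h0)
      rw [mul_eq_zero, or_iff_right hg.ne_zero] at h1 h2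
      simp only [h1, h2] at hc
      exact not_isCoprime_zero_zero hc
    · intro h0
      obtain ⟨g, a', b', hg, hc, rfl, rfl⟩ := exists_monic_mul_isCoprime (a := a) (b := b) (by
        by_contra! h
        exact h0 (Prod.ext h.1 h.2))
      exact ⟨g, (a', b'), hg, hc, trivial, rfl⟩
  rw [h1, Finset.card_erase_add_one (by simp [bot_lt_iff_ne_bot]), Finset.card_product,
    card_lowDegree, sq]

end CoprimePairs

lemma Finset.card_filter_product_eq_sum {α β : Type*} (s : Finset α) (t : Finset β)
    (p : α × β → Prop) [DecidablePred p] :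
    ((s ×ˢ t).filter p).card = ∑ b ∈ t, (s.filter fun a => p (a, b)).card := by
  simp only [Finset.card_filter, Finset.sum_product_right]

lemma not_dvd_right_of_dvd_homogEval {k : Type*} [Field k] {f : k[X][X]} {ℓ a b : k[X]}
    (hirr : Irreducible ℓ) (hlc : ¬ ℓ ∣ f.leadingCoeff) (hab : IsCoprime a b)
    (h : ℓ ∣ homogEval f a b) : ¬ ℓ ∣ b := by
  intro hb
  rw [homogEval, Finset.sum_range_succ, Nat.sub_self, pow_zero, mul_one] at h
  have h1 : ℓ ∣ ∑ i ∈ Finset.range f.natDegree, f.coeff i * a ^ i * b ^ (f.natDegree - i) :=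
    Finset.dvd_sum fun i hi => ((hb.trans (dvd_pow_self b
      (Nat.sub_ne_zero_of_lt (Finset.mem_range.1 hi))))).mul_left _
  have h2 := (dvd_add_right h1).1 h
  have h3 : ℓ ∣ a := hirr.prime.dvd_of_dvd_pow ((hirr.prime.dvd_or_dvd h2).resolve_left hlc)
  exact hirr.not_isUnit (hab.isUnit_of_dvd' h3 hb)

section CountingPairs

variable {k : Type*} [Field k] [Fintype k]

open scoped Classical in
lemma card_filter_not_dvd {ℓ : k[X]} (hℓ : ℓ.Monic) {M : ℕ} (hM : ℓ.natDegree ≤ M) :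
    (((lowDegree k M).filter fun b => ¬ ℓ ∣ b).card : ℝ) =
      (Fintype.card k : ℝ) ^ M - (Fintype.card k : ℝ) ^ (M - ℓ.natDegree) := by
  have h1 := Finset.card_filter_add_card_filter_not (s := lowDegree k M) fun b => ℓ ∣ b
  have h2 := card_filter_dvd_sub hℓ hM 0
  simp only [sub_zero] at h2
  rw [h2, card_lowDegree] at h1
  rw [eq_sub_iff_add_eq']
  exact_mod_cast h1

open scoped Classical in
lemma card_filter_not_dvd_and_dvd_homogEval (f : k[X][X]) {ℓ : k[X]} (hℓ : ℓ.Monic)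
    (hirr : Irreducible ℓ) {M : ℕ} (hM : ℓ.natDegree ≤ M) :
    (((lowDegree k M ×ˢ lowDegree k M).filter fun P =>
        ¬ ℓ ∣ P.2 ∧ ℓ ∣ homogEval f P.1 P.2).card : ℝ) =
      (residueRoots f ℓ).card * (Fintype.card k : ℝ) ^ (M - ℓ.natDegree) *
        ((Fintype.card k : ℝ) ^ M - (Fintype.card k : ℝ) ^ (M - ℓ.natDegree)) := by
  rw [Finset.card_filter_product_eq_sum, ← card_filter_not_dvd hℓ hM]
  have h : ∀ b ∈ lowDegree k M, ((lowDegree k M).filter fun a =>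
      ¬ ℓ ∣ b ∧ ℓ ∣ homogEval f a b).card =
      if ¬ ℓ ∣ b then (residueRoots f ℓ).card * Fintype.card k ^ (M - ℓ.natDegree) else 0 := by
    intro b _
    by_cases hb : ℓ ∣ b
    · simp [hb]
    · simp only [hb, not_false_eq_true, true_and, if_true]
      exact card_filter_dvd_homogEval f hℓ ((hirr.coprime_iff_not_dvd).2 hb) hM
  rw [Finset.sum_congr rfl h, ← Finset.sum_filter, Finset.sum_const, smul_eq_mul]
  push_cast
  ring

open scoped Classical in
lemma card_filter_dvd_and_dvd {ℓ : k[X]} (hℓ : ℓ.Monic) {M : ℕ} (hM : ℓ.natDegree ≤ M) :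
    ((lowDegree k M ×ˢ lowDegree k M).filter fun P => ℓ ∣ P.1 ∧ ℓ ∣ P.2).card =
      (Fintype.card k ^ (M - ℓ.natDegree)) ^ 2 := by
  have h2 := card_filter_dvd_sub hℓ hM 0
  simp only [sub_zero] at h2
  have h : ((lowDegree k M ×ˢ lowDegree k M).filter fun P => ℓ ∣ P.1 ∧ ℓ ∣ P.2) =
      ((lowDegree k M).filter fun a => ℓ ∣ a) ×ˢ ((lowDegree k M).filter fun a => ℓ ∣ a) := by
    ext P
    simp only [Finset.mem_filter, Finset.mem_product]
    tauto
  rw [h, Finset.card_product, h2, sq]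

/-- The condition `ℓ ∣ F(a, b)`. -/
def DvdHomogEval (f : k[X][X]) (ℓ : k[X]) (P : k[X] × k[X]) : Prop := ℓ ∣ homogEval f P.1 P.2

lemma card_scaledPairs_dvd_bounds {f : k[X][X]} {ℓ : k[X]} (hℓ : ℓ.Monic) (hirr : Irreducible ℓ)
    (hlc : ¬ ℓ ∣ f.leadingCoeff) {N : ℕ} (hN : ℓ.natDegree ≤ N + 1) :
    (residueRoots f ℓ).card * (Fintype.card k : ℝ) ^ (N + 1 - ℓ.natDegree) *
        ((Fintype.card k : ℝ) ^ (N + 1) - (Fintype.card k : ℝ) ^ (N + 1 - ℓ.natDegree)) ≤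
      (scaledPairs (DvdHomogEval f ℓ) N).card ∧
    ((scaledPairs (DvdHomogEval f ℓ) N).card : ℝ) ≤
      (residueRoots f ℓ).card * (Fintype.card k : ℝ) ^ (N + 1 - ℓ.natDegree) *
        ((Fintype.card k : ℝ) ^ (N + 1) - (Fintype.card k : ℝ) ^ (N + 1 - ℓ.natDegree)) +
      ((Fintype.card k : ℝ) ^ (N + 1 - ℓ.natDegree)) ^ 2 := by
  classical
  rw [← card_filter_not_dvd_and_dvd_homogEval f hℓ hirr hN]
  constructor
  · refine Nat.cast_le.2 (Finset.card_le_card ?_)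
    rintro ⟨a, b⟩ hP
    simp only [Finset.mem_filter, Finset.mem_product, mem_lowDegree, mem_scaledPairs] at hP ⊢
    obtain ⟨hP, hb, hF⟩ := hP
    refine ⟨hP, ?_⟩
    obtain ⟨g, a', b', hg, hc, rfl, rfl⟩ := exists_monic_mul_isCoprime (a := a) (b := b)
      (Or.inr fun h => hb (h ▸ dvd_zero ℓ))
    refine ⟨g, (a', b'), hg, hc, ?_, rfl⟩
    rw [homogEval_mul_mul] at hF
    refine (hirr.prime.dvd_or_dvd hF).resolve_left fun h => hb ?_
    exact (hirr.prime.dvd_of_dvd_pow h).mul_right _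
  · have h : scaledPairs (DvdHomogEval f ℓ) N ⊆
        ((lowDegree k (N + 1) ×ˢ lowDegree k (N + 1)).filter fun P =>
          ¬ ℓ ∣ P.2 ∧ ℓ ∣ homogEval f P.1 P.2) ∪
        ((lowDegree k (N + 1) ×ˢ lowDegree k (N + 1)).filter fun P => ℓ ∣ P.1 ∧ ℓ ∣ P.2) := by
      rintro ⟨a, b⟩ hP
      rw [mem_scaledPairs] at hP
      obtain ⟨hP, g, ⟨a', b'⟩, hg, hc, hp, h⟩ := hP
      rw [Prod.mk.injEq] at h
      simp only [Finset.mem_union, Finset.mem_filter, Finset.mem_product, mem_lowDegree,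
        and_iff_right hP]
      rw [h.1, h.2]
      have hb' := not_dvd_right_of_dvd_homogEval hirr hlc hc hp
      by_cases hgl : ℓ ∣ g
      · exact Or.inr ⟨hgl.mul_right _, hgl.mul_right _⟩
      · refine Or.inl ⟨fun h1 => (hirr.prime.dvd_or_dvd h1).elim hgl hb', ?_⟩
        rw [homogEval_mul_mul]
        exact hp.mul_left _
    have h2 := (Finset.card_le_card h).trans (Finset.card_union_le _ _)
    rw [card_filter_dvd_and_dvd hℓ hN] at h2
    exact_mod_cast h2

lemma abs_card_coprimePairs_dvd_sub_le {f : k[X][X]} {ℓ : k[X]} (hℓ : ℓ.Monic)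
    (hirr : Irreducible ℓ) (hlc : ¬ ℓ ∣ f.leadingCoeff) {N : ℕ} (hN : ℓ.natDegree ≤ N)
    (h1 : 1 ≤ N) {q x : ℝ} (hq : q = Fintype.card k) (hx : x = 1 / q ^ ℓ.natDegree) :
    |(coprimePairs (DvdHomogEval f ℓ) N).card -
        (residueRoots f ℓ).card * x * (1 - x) * (1 - 1 / q) * (q ^ (N + 1)) ^ 2| ≤
      x ^ 2 * (q ^ (N + 1)) ^ 2 := by
  obtain ⟨N, rfl⟩ := Nat.exists_eq_add_of_le' h1
  have hq0 : (1 : ℝ) ≤ q := by rw [hq]; exact_mod_cast Fintype.card_pos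
  have hq1 : q ≠ 0 := by positivity
  have hpow : ∀ M, ℓ.natDegree ≤ M → q ^ (M - ℓ.natDegree) = q ^ M * x := by
    intro M hM
    rw [hx, pow_sub₀ _ hq1 hM, one_div]
  obtain ⟨a1, a2⟩ := card_scaledPairs_dvd_bounds hℓ hirr hlc hN
  obtain ⟨b1, b2⟩ := card_scaledPairs_dvd_bounds hℓ hirr hlc (hN.trans (Nat.le_succ _))
  have hrec : ((scaledPairs (DvdHomogEval f ℓ) (N + 1)).card : ℝ) =
      (coprimePairs (DvdHomogEval f ℓ) (N + 1)).card +
        q * (scaledPairs (DvdHomogEval f ℓ) N).card := by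
    rw [hq]; exact_mod_cast card_scaledPairs_succ (DvdHomogEval f ℓ) N
  rw [← hq, hpow _ hN] at a1 a2
  rw [← hq, hpow _ (hN.trans (Nat.le_succ _))] at b1 b2
  set n : ℝ := ((residueRoots f ℓ).card : ℝ)
  set c : ℝ := ((coprimePairs (DvdHomogEval f ℓ) (N + 1)).card : ℝ)
  set s : ℝ := ((scaledPairs (DvdHomogEval f ℓ) N).card : ℝ)
  rw [hrec, pow_succ] at b1 b2
  rw [pow_succ q (N + 1)]
  generalize q ^ (N + 1) = y at *
  have e1 : n * x * (1 - x) * (1 - 1 / q) * (y * q) ^ 2 =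
      n * x * (1 - x) * (y * q) ^ 2 - q * (n * x * (1 - x) * y ^ 2) := by
    field_simp
  rw [e1, abs_le]
  have a1' := mul_le_mul_of_nonneg_left a1 (zero_le_one.trans hq0)
  have a2' := mul_le_mul_of_nonneg_left a2 (zero_le_one.trans hq0)
  have e2 : q * x ^ 2 * y ^ 2 ≤ q ^ 2 * x ^ 2 * y ^ 2 := by
    have : q ≤ q ^ 2 := by nlinarith
    gcongr
  constructor
  · linarith
  · linarith

end CountingPairs

lemma natDegree_homogEval_le {k : Type*} [Field k] (f : k[X][X]) {a b : k[X]} {N : ℕ}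
    (ha : a.natDegree ≤ N) (hb : b.natDegree ≤ N) :
    (homogEval f a b).natDegree ≤
      ((Finset.range (f.natDegree + 1)).sup fun i => (f.coeff i).natDegree) + f.natDegree * N := by
  refine natDegree_sum_le_of_forall_le _ _ fun i hi => ?_
  refine natDegree_mul_le.trans ((Nat.add_le_add_right natDegree_mul_le _).trans ?_)
  have h1 : (f.coeff i).natDegree ≤
      (Finset.range (f.natDegree + 1)).sup fun i => (f.coeff i).natDegree :=
    Finset.le_sup (f := fun i => (f.coeff i).natDegree) hi
  have h2 : (a ^ i).natDegree ≤ i * N := natDegree_pow_le_of_le i ha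
  have h3 : (b ^ (f.natDegree - i)).natDegree ≤ (f.natDegree - i) * N := natDegree_pow_le_of_le _ hb
  have h4 : i * N + (f.natDegree - i) * N = f.natDegree * N := by
    rw [← add_mul]; congr 1; have := Finset.mem_range.1 hi; omega
  omega

lemma multiplicity_le_natDegree {k : Type*} [Field k] {ℓ z : k[X]} (hirr : Irreducible ℓ)
    (hz : z ≠ 0) : multiplicity ℓ z ≤ z.natDegree := by
  have h := natDegree_le_of_dvd (pow_multiplicity_dvd ℓ z) hz
  rw [natDegree_pow] at h
  exact (Nat.le_mul_of_pos_right _ hirr.natDegree_pos).trans h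

open scoped Classical in
lemma multiplicity_eq_card_filter {k : Type*} [Field k] {ℓ z : k[X]} (hirr : Irreducible ℓ)
    (hz : z ≠ 0) {B : ℕ} (hB : z.natDegree ≤ B) :
    multiplicity ℓ z = ((Finset.Icc 1 B).filter fun j => ℓ ^ j ∣ z).card := by
  have hfin : FiniteMultiplicity ℓ z :=
    FiniteMultiplicity.of_prime_left hirr.prime hz
  have hle := (multiplicity_le_natDegree hirr hz).trans hB
  have h : ((Finset.Icc 1 B).filter fun j => ℓ ^ j ∣ z) = Finset.Icc 1 (multiplicity ℓ z) := by
    ext j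
    simp only [Finset.mem_filter, Finset.mem_Icc, hfin.pow_dvd_iff_le_multiplicity]
    omega
  rw [h, Nat.card_Icc, Nat.add_sub_cancel]

lemma sum_multiplicity_eq_sum_card {k : Type*} [Field k] {ι : Type*} {ℓ : k[X]}
    (hirr : Irreducible ℓ) (S : Finset ι) (F : ι → k[X]) {B : ℕ} (h0 : ∀ i ∈ S, F i ≠ 0)
    (hB : ∀ i ∈ S, (F i).natDegree ≤ B) [∀ j, DecidablePred fun i => ℓ ^ j ∣ F i] :
    ∑ i ∈ S, multiplicity ℓ (F i) =
      ∑ j ∈ Finset.Icc 1 B, (S.filter fun i => ℓ ^ j ∣ F i).card := by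
  classical
  rw [Finset.sum_congr rfl fun i hi => multiplicity_eq_card_filter hirr (h0 i hi) (hB i hi)]
  simp only [Finset.card_filter]
  exact Finset.sum_comm.trans (by congr! 4)

section Averages

variable {k : Type*} [Field k] [Fintype k]

/-- The condition `F(a, b) ≠ 0`. -/
def HomogEvalNeZero (f : k[X][X]) (P : k[X] × k[X]) : Prop := homogEval f P.1 P.2 ≠ 0

lemma card_coprimePairs_true_succ (N : ℕ) :
    ((coprimePairs (fun _ : k[X] × k[X] => True) (N + 1)).card : ℝ) =
      ((Fintype.card k : ℝ) ^ (N + 2)) ^ 2 * (1 - 1 / Fintype.card k) + Fintype.card k - 1 := by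
  have h1 := card_scaledPairs_true (k := k) (N + 1)
  have h2 := card_scaledPairs_true (k := k) N
  rw [card_scaledPairs_succ] at h1
  have hq : (Fintype.card k : ℝ) ≠ 0 := by exact_mod_cast Fintype.card_ne_zero
  have h1' := congrArg (Nat.cast : ℕ → ℝ) h1
  have h2' := congrArg (Nat.cast : ℕ → ℝ) h2
  push_cast at h1' h2'
  rw [pow_succ _ (N + 1)] at h1' ⊢
  field_simp
  linear_combination h1' - (Fintype.card k : ℝ) * h2'

open scoped Classical in
lemma card_filter_homogEval_eq_zero_prod_le {f : k[X][X]} (hf : f ≠ 0) (M : ℕ) :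
    ((lowDegree k M ×ˢ lowDegree k M).filter fun P => homogEval f P.1 P.2 = 0).card ≤
      f.natDegree * Fintype.card k ^ M := by
  rw [Finset.card_filter_product_eq_sum]
  refine (Finset.sum_le_card_nsmul _ _ _ fun b _ =>
    card_filter_homogEval_eq_zero_le hf b M).trans ?_
  rw [card_lowDegree, smul_eq_mul, mul_comm]

lemma card_coprimePairs_le_add {f : k[X][X]} (hf : f ≠ 0) (p : k[X] × k[X] → Prop) (N : ℕ) :
    (coprimePairs p N).card ≤
      (coprimePairs (fun P => p P ∧ HomogEvalNeZero f P) N).card +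
        f.natDegree * Fintype.card k ^ (N + 1) := by
  classical
  refine le_trans ?_ (Nat.add_le_add_left (card_filter_homogEval_eq_zero_prod_le hf (N + 1)) _)
  refine (Finset.card_le_card fun P hP => ?_).trans (Finset.card_union_le _ _)
  rw [mem_coprimePairs] at hP
  simp only [Finset.mem_union, mem_coprimePairs, Finset.mem_filter, Finset.mem_product,
    mem_lowDegree, HomogEvalNeZero]
  tauto

lemma card_coprimePairs_mono {p p' : k[X] × k[X] → Prop} (h : ∀ P, p P → p' P) (N : ℕ) :
    (coprimePairs p N).card ≤ (coprimePairs p' N).card := by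
  refine Finset.card_le_card fun P hP => ?_
  rw [mem_coprimePairs] at hP ⊢
  exact ⟨hP.1, hP.2.1, h _ hP.2.2⟩

lemma one_lt_card_real : (1 : ℝ) < Fintype.card k := by exact_mod_cast Fintype.one_lt_card

lemma tendsto_inv_card_pow_succ :
    Tendsto (fun N : ℕ => ((Fintype.card k : ℝ) ^ (N + 1))⁻¹) atTop (nhds 0) :=
  ((tendsto_add_atTop_iff_nat 1).2
    (tendsto_pow_atTop_atTop_of_one_lt (one_lt_card_real (k := k)))).inv_tendsto_atTop

lemma tendsto_card_coprimePairs_ne_zero {f : k[X][X]} (hf : f ≠ 0) :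
    Tendsto (fun N : ℕ => ((coprimePairs (HomogEvalNeZero f) N).card : ℝ) /
      ((Fintype.card k : ℝ) ^ (N + 1)) ^ 2) atTop (nhds (1 - 1 / Fintype.card k)) := by
  have hq := one_lt_card_real (k := k)
  have ht := tendsto_inv_card_pow_succ (k := k)
  have hev : ∀ᶠ N : ℕ in atTop, ((coprimePairs (fun _ : k[X] × k[X] => True) N).card : ℝ) =
      ((Fintype.card k : ℝ) ^ (N + 1)) ^ 2 * (1 - 1 / Fintype.card k) + Fintype.card k - 1 := by
    filter_upwards [eventually_ge_atTop 1] with N hN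
    obtain ⟨N, rfl⟩ := Nat.exists_eq_add_of_le' hN
    exact card_coprimePairs_true_succ N
  generalize hqq : (Fintype.card k : ℝ) = q at *
  have hlow : Tendsto (fun N : ℕ => (1 - 1 / q) + (q - 1) * ((q ^ (N + 1))⁻¹) ^ 2 -
      f.natDegree * (q ^ (N + 1))⁻¹) atTop (nhds (1 - 1 / q)) := by
    have := ((ht.pow 2).const_mul (q - 1)).const_add (1 - 1 / q)
      |>.sub (ht.const_mul (f.natDegree : ℝ))
    simpa using this
  have hup : Tendsto (fun N : ℕ => (1 - 1 / q) + (q - 1) * ((q ^ (N + 1))⁻¹) ^ 2)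
      atTop (nhds (1 - 1 / q)) := by
    simpa using ((ht.pow 2).const_mul (q - 1)).const_add (1 - 1 / q)
  refine tendsto_of_tendsto_of_tendsto_of_le_of_le' hlow hup ?_ ?_
  · filter_upwards [hev] with N hN
    have h1 := card_coprimePairs_le_add hf (fun _ : k[X] × k[X] => True) N
    have h2 : (coprimePairs (fun P => True ∧ HomogEvalNeZero f P) N).card ≤
      (coprimePairs (HomogEvalNeZero f) N).card := card_coprimePairs_mono (fun P h => h.2) N
    have h3 : ((coprimePairs (fun _ : k[X] × k[X] => True) N).card : ℝ) ≤
        (coprimePairs (HomogEvalNeZero f) N).card + f.natDegree * q ^ (N + 1) := by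
      rw [← hqq]; exact_mod_cast h1.trans (Nat.add_le_add_right h2 _)
    have hy : 0 < q ^ (N + 1) := by positivity
    rw [le_div_iff₀ (by positivity)]
    rw [hN] at h3
    generalize q ^ (N + 1) = y at *
    have e : (1 - 1 / q + (q - 1) * y⁻¹ ^ 2 - f.natDegree * y⁻¹) * y ^ 2 =
        y ^ 2 * (1 - 1 / q) + (q - 1) - f.natDegree * y := by
      field_simp
    rw [e]; linarith
  · filter_upwards [hev] with N hN
    have h2 : (coprimePairs (HomogEvalNeZero f) N).card ≤
      (coprimePairs (fun _ : k[X] × k[X] => True) N).card :=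
        card_coprimePairs_mono (fun P h => trivial) N
    have h3 := (Nat.cast_le (α := ℝ)).2 h2
    rw [hN] at h3
    have hy : 0 < q ^ (N + 1) := by positivity
    rw [div_le_iff₀ (by positivity)]
    generalize q ^ (N + 1) = y at *
    have e : (1 - 1 / q + (q - 1) * y⁻¹ ^ 2) * y ^ 2 = y ^ 2 * (1 - 1 / q) + (q - 1) := by
      field_simp
    rw [e]; linarith

/-- The sum of the `ℓ`-adic valuations of `F(a, b)` over coprime pairs of degree at most `N`. -/
noncomputable def sumMultiplicity (f : k[X][X]) (ℓ : k[X]) (N : ℕ) : ℝ :=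
  ∑ P ∈ coprimePairs (HomogEvalNeZero f) N, (multiplicity ℓ (homogEval f P.1 P.2) : ℝ)

lemma le_sumMultiplicity {f : k[X][X]} (hf : f ≠ 0) {ℓ : k[X]} (hirr : Irreducible ℓ) (N : ℕ) :
    ((coprimePairs (DvdHomogEval f ℓ) N).card : ℝ) - f.natDegree * (Fintype.card k : ℝ) ^ (N + 1) ≤
      sumMultiplicity f ℓ N := by
  have h1 : ((coprimePairs (DvdHomogEval f ℓ) N).card : ℝ) ≤
      (coprimePairs (fun P => DvdHomogEval f ℓ P ∧ HomogEvalNeZero f P) N).card +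
        f.natDegree * (Fintype.card k : ℝ) ^ (N + 1) := by
    exact_mod_cast card_coprimePairs_le_add hf (DvdHomogEval f ℓ) N
  have h2 : ((coprimePairs (fun P => DvdHomogEval f ℓ P ∧ HomogEvalNeZero f P) N).card : ℝ) ≤
      sumMultiplicity f ℓ N := by
    rw [sumMultiplicity, Finset.card_eq_sum_ones, Nat.cast_sum]
    refine (Finset.sum_le_sum (fun P hP => ?_)).trans
      (Finset.sum_le_sum_of_subset_of_nonneg (fun P hP => ?_) fun _ _ _ => Nat.cast_nonneg _)
    · rw [mem_coprimePairs] at hP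
      obtain ⟨-, -, hd, h0⟩ := hP
      have hfin : FiniteMultiplicity ℓ (homogEval f P.1 P.2) :=
        FiniteMultiplicity.of_prime_left hirr.prime h0
      have := hfin.pow_dvd_iff_le_multiplicity (k := 1)
      rw [pow_one] at this
      exact Nat.cast_le.2 (this.1 hd)
    · rw [mem_coprimePairs] at hP ⊢
      exact ⟨hP.1, hP.2.1, hP.2.2.2⟩
  linarith

open scoped Classical in
lemma card_filter_pow_dvd_le {f u v : k[X][X]} {D ℓ : k[X]} (hf : 1 ≤ f.natDegree) (hℓ : ℓ.Monic)
    (hirr : Irreducible ℓ) (hlc : ¬ ℓ ∣ f.leadingCoeff) (huv : u * f + v * derivative f = C D)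
    (hD : ¬ ℓ ∣ D) {j : ℕ} (hj : j ≠ 0) (N : ℕ) :
    (((coprimePairs (HomogEvalNeZero f) N).filter fun P =>
        ℓ ^ j ∣ homogEval f P.1 P.2).card : ℝ) ≤
      (Fintype.card k : ℝ) ^ (N + 1) * (f.natDegree * ((Fintype.card k : ℝ) ^ (N + 1) *
        (1 / (Fintype.card k : ℝ) ^ ℓ.natDegree) ^ j + 1)) := by
  have h1 : ((coprimePairs (HomogEvalNeZero f) N).filter fun P => ℓ ^ j ∣ homogEval f P.1 P.2) ⊆
      (lowDegree k (N + 1) ×ˢ lowDegree k (N + 1)).filter fun P =>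
        IsCoprime (ℓ ^ j) P.2 ∧ ℓ ^ j ∣ homogEval f P.1 P.2 := by
    intro P hP
    simp only [Finset.mem_filter, mem_coprimePairs, Finset.mem_product, mem_lowDegree] at hP ⊢
    refine ⟨hP.1.1, ?_, hP.2⟩
    exact (hirr.coprime_iff_not_dvd.2 (not_dvd_right_of_dvd_homogEval hirr hlc hP.1.2.1
      ((dvd_pow_self ℓ hj).trans hP.2))).pow_left
  refine (Nat.cast_le.2 (Finset.card_le_card h1)).trans ?_
  rw [Finset.card_filter_product_eq_sum, Nat.cast_sum]
  have h2 : ∀ b ∈ lowDegree k (N + 1), ((((lowDegree k (N + 1)).filter fun a =>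
      IsCoprime (ℓ ^ j) b ∧ ℓ ^ j ∣ homogEval f a b).card : ℕ) : ℝ) ≤
      f.natDegree * ((Fintype.card k : ℝ) ^ (N + 1) *
        (1 / (Fintype.card k : ℝ) ^ ℓ.natDegree) ^ j + 1) := by
    intro b _
    by_cases hb : IsCoprime (ℓ ^ j) b
    · simp only [hb, true_and]
      refine (card_filter_dvd_homogEval_le f (hℓ.pow j) hb (N + 1)).trans ?_
      rw [natDegree_pow, one_div, inv_pow, ← div_eq_mul_inv, ← pow_mul, mul_comm j]
      gcongr
      exact (card_residueRoots_pow_le hℓ hirr huv hD hj).trans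
        (card_residueRoots_le_natDegree hf hℓ hirr hlc)
    · simp only [hb, false_and, Finset.filter_false, Finset.card_empty, Nat.cast_zero]
      positivity
  refine (Finset.sum_le_card_nsmul _ _ _ h2).trans ?_
  rw [card_lowDegree, nsmul_eq_mul, Nat.cast_pow]

lemma sum_Icc_two_pow_le {x : ℝ} (hx0 : 0 ≤ x) (hx : x ≤ 1 / 2) (B : ℕ) :
    ∑ j ∈ Finset.Icc 2 B, x ^ j ≤ 2 * x ^ 2 := by
  suffices h : ∀ B : ℕ, ∑ j ∈ Finset.Icc 2 (B + 1), x ^ j ≤ 2 * x ^ 2 - 2 * x ^ (B + 2) by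
    rcases B with - | B
    · simp; positivity
    · exact (h B).trans (by have := pow_nonneg hx0 (B + 2); linarith)
  intro B
  induction B with
  | zero => simp
  | succ B ih =>
    rw [Finset.sum_Icc_succ_top (by omega)]
    have h1 : x ^ (B + 1 + 2) ≤ x ^ (B + 2) * (1 / 2) := by
      rw [show B + 1 + 2 = (B + 2) + 1 by ring, pow_succ]
      gcongr
    rw [show B + 1 + 1 = B + 2 by ring] at *
    linarith

lemma sumMultiplicity_le {f u v : k[X][X]} {D ℓ : k[X]} (hf : 1 ≤ f.natDegree) (hℓ : ℓ.Monic)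
    (hirr : Irreducible ℓ) (hlc : ¬ ℓ ∣ f.leadingCoeff) (huv : u * f + v * derivative f = C D)
    (hD : ¬ ℓ ∣ D) {q x : ℝ} (hq : q = Fintype.card k) (hx : x = 1 / q ^ ℓ.natDegree)
    (hx2 : x ≤ 1 / 2) (N : ℕ) :
    sumMultiplicity f ℓ N ≤ (coprimePairs (DvdHomogEval f ℓ) N).card +
      q ^ (N + 1) * (f.natDegree * (q ^ (N + 1) * (2 * x ^ 2) +
        (((Finset.range (f.natDegree + 1)).sup fun i => (f.coeff i).natDegree) +
          f.natDegree * N : ℕ))) := by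
  classical
  set B := ((Finset.range (f.natDegree + 1)).sup fun i => (f.coeff i).natDegree) + f.natDegree * N
    with hB
  have hq0 : 0 < q := by rw [hq]; exact zero_lt_one.trans one_lt_card_real
  have hx0 : 0 ≤ x := by rw [hx]; positivity
  have hdeg : ∀ P ∈ coprimePairs (HomogEvalNeZero f) N, (homogEval f P.1 P.2).natDegree ≤ B := by
    intro P hP
    rw [mem_coprimePairs] at hP
    have key : ∀ a : k[X], a.degree < (N + 1 : ℕ) → a.natDegree ≤ N := fun a ha =>
      natDegree_le_of_degree_le (Order.le_of_lt_succ (by exact_mod_cast ha))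
    exact natDegree_homogEval_le f (key _ hP.1.1) (key _ hP.1.2)
  have h0 : ∀ P ∈ coprimePairs (HomogEvalNeZero f) N, homogEval f P.1 P.2 ≠ 0 := fun P hP =>
    (mem_coprimePairs.1 hP).2.2
  have h1 : sumMultiplicity f ℓ N = ∑ j ∈ Finset.Icc 1 B,
      (((coprimePairs (HomogEvalNeZero f) N).filter fun P =>
        ℓ ^ j ∣ homogEval f P.1 P.2).card : ℝ) := by
    have := sum_multiplicity_eq_sum_card hirr (coprimePairs (HomogEvalNeZero f) N)
      (fun P => homogEval f P.1 P.2) h0 hdeg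
    rw [sumMultiplicity]
    exact_mod_cast this
  have hsub : Finset.Icc 1 B ⊆ insert 1 (Finset.Icc 2 B) := by
    intro j hj
    rw [Finset.mem_Icc] at hj
    rw [Finset.mem_insert, Finset.mem_Icc]
    omega
  rw [h1]
  refine (Finset.sum_le_sum_of_subset_of_nonneg hsub fun _ _ _ => Nat.cast_nonneg _).trans ?_
  rw [Finset.sum_insert (by simp)]
  refine add_le_add (Nat.cast_le.2 (Finset.card_le_card fun P hP => ?_)) ?_
  · rw [Finset.mem_filter, mem_coprimePairs, pow_one] at hP
    rw [mem_coprimePairs]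
    exact ⟨hP.1.1, hP.1.2.1, hP.2⟩
  · have h2 : ∀ j ∈ Finset.Icc 2 B, (((coprimePairs (HomogEvalNeZero f) N).filter fun P =>
        ℓ ^ j ∣ homogEval f P.1 P.2).card : ℝ) ≤
        q ^ (N + 1) * (f.natDegree * (q ^ (N + 1) * x ^ j + 1)) := by
      intro j hj
      rw [Finset.mem_Icc] at hj
      rw [hx, hq]
      exact card_filter_pow_dvd_le hf hℓ hirr hlc huv hD (by omega) N
    refine (Finset.sum_le_sum h2).trans ?_
    rw [← Finset.mul_sum, ← Finset.mul_sum, Finset.sum_add_distrib, ← Finset.mul_sum]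
    gcongr
    · exact sum_Icc_two_pow_le hx0 hx2 B
    · simp

end Averages

section LocalAverages

variable {k : Type*} [Field k] [Fintype k]

lemma tendsto_add_mul_div_card_pow_succ (H n : ℕ) :
    Tendsto (fun N : ℕ => ((H + n * N : ℕ) : ℝ) / (Fintype.card k : ℝ) ^ (N + 1)) atTop
      (nhds 0) := by
  have hq := one_lt_card_real (k := k)
  have h1 := (tendsto_pow_const_div_const_pow_of_one_lt 1 hq).mul_const
    ((n : ℝ) * (Fintype.card k : ℝ)⁻¹)
  have h2 := (tendsto_inv_card_pow_succ (k := k)).const_mul (H : ℝ)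
  have h3 := h2.add h1
  simp only [mul_zero, zero_mul, add_zero] at h3
  refine h3.congr fun N => ?_
  have : (Fintype.card k : ℝ) ≠ 0 := by positivity
  push_cast
  field_simp
  ring

lemma abs_sub_le_of_tendsto_sumMultiplicity {f u v : k[X][X]} {D ℓ : k[X]} (hf : 1 ≤ f.natDegree)
    (hℓ : ℓ.Monic) (hirr : Irreducible ℓ) (hlc : ¬ ℓ ∣ f.leadingCoeff)
    (huv : u * f + v * derivative f = C D) (hD : ¬ ℓ ∣ D) {q x A : ℝ} (hq : q = Fintype.card k)
    (hx : x = 1 / q ^ ℓ.natDegree) (hx2 : x ≤ 1 / 2)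
    (hA : Tendsto (fun N => sumMultiplicity f ℓ N / (coprimePairs (HomogEvalNeZero f) N).card)
      atTop (nhds A)) :
    |A - (residueRoots f ℓ).card * x| ≤ (2 + 5 * f.natDegree) * x ^ 2 := by
  have hf0 : f ≠ 0 := by rintro rfl; simp at hf
  have hq1 : 2 ≤ q := by rw [hq]; exact_mod_cast Fintype.one_lt_card
  have hq0 : 0 < q := by linarith
  have hn : ((residueRoots f ℓ).card : ℝ) ≤ f.natDegree :=
    Nat.cast_le.2 (card_residueRoots_le_natDegree hf hℓ hirr hlc)
  set n : ℝ := ((f.natDegree : ℕ) : ℝ) with hn'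
  set r : ℝ := ((residueRoots f ℓ).card : ℝ) with hr
  set θ : ℝ := 1 - 1 / q with hθ
  have hθ2 : 1 / 2 ≤ θ := by
    have : 1 / q ≤ 1 / 2 := one_div_le_one_div_of_le two_pos hq1
    linarith
  have hlim : Tendsto (fun N => sumMultiplicity f ℓ N / (q ^ (N + 1)) ^ 2) atTop
      (nhds (A * θ)) := by
    have h := hA.mul (tendsto_card_coprimePairs_ne_zero hf0)
    rw [← hq] at h
    refine h.congr fun N => ?_
    rcases Finset.eq_empty_or_nonempty (coprimePairs (HomogEvalNeZero f) N) with h0 | h0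
    · simp [sumMultiplicity, h0]
    · have : ((coprimePairs (HomogEvalNeZero f) N).card : ℝ) ≠ 0 := by
        exact_mod_cast h0.card_pos.ne'
      field_simp
  have ht := tendsto_inv_card_pow_succ (k := k)
  have htB := tendsto_add_mul_div_card_pow_succ (k := k)
    ((Finset.range (f.natDegree + 1)).sup fun i => (f.coeff i).natDegree) f.natDegree
  rw [← hq] at ht htB
  have hlow : r * x * (1 - x) * θ - x ^ 2 ≤ A * θ := by
    have h := (ht.const_mul n).const_sub (r * x * (1 - x) * θ - x ^ 2)
    rw [mul_zero, sub_zero] at h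
    refine le_of_tendsto_of_tendsto h hlim ?_
    filter_upwards [eventually_ge_atTop (ℓ.natDegree), eventually_ge_atTop 1] with N hN hN1
    have h1 := (abs_le.1 (abs_card_coprimePairs_dvd_sub_le hℓ hirr hlc hN hN1 hq hx)).1
    have h2 := le_sumMultiplicity hf0 hirr N
    rw [← hq] at h2
    have hy : 0 < q ^ (N + 1) := by positivity
    rw [le_div_iff₀ (by positivity)]
    generalize q ^ (N + 1) = y at *
    have e : (r * x * (1 - x) * θ - x ^ 2 - n * y⁻¹) * y ^ 2 =
        r * x * (1 - x) * θ * y ^ 2 - x ^ 2 * y ^ 2 - n * y := by field_simp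
    rw [e]
    linarith
  have hup : A * θ ≤ r * x * (1 - x) * θ + x ^ 2 + n * (2 * x ^ 2) := by
    have h := (htB.const_mul n).const_add (r * x * (1 - x) * θ + x ^ 2 + n * (2 * x ^ 2))
    rw [mul_zero, add_zero] at h
    refine le_of_tendsto_of_tendsto hlim h ?_
    filter_upwards [eventually_ge_atTop (ℓ.natDegree), eventually_ge_atTop 1] with N hN hN1
    have h1 := (abs_le.1 (abs_card_coprimePairs_dvd_sub_le hℓ hirr hlc hN hN1 hq hx)).2
    have h2 := sumMultiplicity_le hf hℓ hirr hlc huv hD hq hx hx2 N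
    have hy : 0 < q ^ (N + 1) := by positivity
    rw [div_le_iff₀ (by positivity)]
    generalize q ^ (N + 1) = y at *
    generalize (((Finset.range (f.natDegree + 1)).sup fun i => (f.coeff i).natDegree) +
      f.natDegree * N : ℕ) = B at *
    have e : (r * x * (1 - x) * θ + x ^ 2 + n * (2 * x ^ 2) + n * (B / y)) * y ^ 2 =
        r * x * (1 - x) * θ * y ^ 2 + x ^ 2 * y ^ 2 + y * (n * (y * (2 * x ^ 2) + B)) := by
      field_simp
      ring
    rw [e]
    linarith
  have hθ0 : 0 < θ := by linarith
  have hx0 : 0 ≤ x ^ 2 := sq_nonneg x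
  have hn0 : 0 ≤ n := Nat.cast_nonneg _
  have hr0 : 0 ≤ r := Nat.cast_nonneg _
  have key : ∀ z : ℝ, 0 ≤ z → z ≤ 2 * θ * z := fun z hz => by nlinarith
  have k1 := key (x ^ 2) hx0
  have k2 := key (x ^ 2 + n * (2 * x ^ 2)) (by positivity)
  have hlow' : r * x * (1 - x) - 2 * x ^ 2 ≤ A := by
    refine le_of_mul_le_mul_right ?_ hθ0
    linarith
  have hup' : A ≤ r * x * (1 - x) + 2 * (x ^ 2 + n * (2 * x ^ 2)) := by
    refine le_of_mul_le_mul_right ?_ hθ0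
    linarith
  have hrn : r * x ^ 2 ≤ n * x ^ 2 := mul_le_mul_of_nonneg_right hn hx0
  have hrx : 0 ≤ r * x ^ 2 := by positivity
  have hnx : 0 ≤ n * x ^ 2 := by positivity
  rw [abs_le]
  constructor
  · linarith
  · linarith

/-- The sum of the `ℓ`-adic valuations of the nonzero polynomials of degree at most `N`. -/
noncomputable def sumMultiplicityLowDegree (ℓ : k[X]) (N : ℕ) : ℝ :=
  open scoped Classical in ∑ P ∈ (lowDegree k (N + 1)).erase 0, (multiplicity ℓ P : ℝ)

lemma le_sumMultiplicityLowDegree {ℓ : k[X]} (hℓ : ℓ.Monic) (hirr : Irreducible ℓ) {N : ℕ}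
    (hN : ℓ.natDegree ≤ N + 1) :
    (Fintype.card k : ℝ) ^ (N + 1) * (1 / (Fintype.card k : ℝ) ^ ℓ.natDegree) - 1 ≤
      sumMultiplicityLowDegree ℓ N := by
  classical
  have hq : (Fintype.card k : ℝ) ≠ 0 := by positivity
  have h1 := card_filter_dvd_sub hℓ hN 0
  have h0 : (0 : k[X]) ∈ (lowDegree k (N + 1)).filter fun P => ℓ ∣ P - 0 := by
    simp [bot_lt_iff_ne_bot]
  rw [one_div, ← pow_sub₀ _ hq hN, sub_le_iff_le_add]
  rw [← Finset.card_erase_add_one h0] at h1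
  have h2 : ((((lowDegree k (N + 1)).filter fun P => ℓ ∣ P - 0).erase 0).card : ℝ) + 1 =
      (Fintype.card k : ℝ) ^ (N + 1 - ℓ.natDegree) := by exact_mod_cast h1
  rw [← h2, sumMultiplicityLowDegree]
  gcongr
  rw [Finset.card_eq_sum_ones, Nat.cast_sum]
  refine (Finset.sum_le_sum (fun P hP => ?_)).trans
    (Finset.sum_le_sum_of_subset_of_nonneg (fun P hP => ?_) fun _ _ _ => Nat.cast_nonneg _)
  · simp only [Finset.mem_erase, Finset.mem_filter, sub_zero] at hP
    have hfin : FiniteMultiplicity ℓ P := FiniteMultiplicity.of_prime_left hirr.prime hP.1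
    have := hfin.pow_dvd_iff_le_multiplicity (k := 1)
    rw [pow_one] at this
    exact Nat.cast_le.2 (this.1 hP.2.2)
  · simp only [Finset.mem_erase, Finset.mem_filter] at hP ⊢
    exact ⟨hP.1, hP.2.1⟩

lemma sumMultiplicityLowDegree_le {ℓ : k[X]} (hℓ : ℓ.Monic) (hirr : Irreducible ℓ) {q x : ℝ}
    (hq : q = Fintype.card k) (hx : x = 1 / q ^ ℓ.natDegree) (hx2 : x ≤ 1 / 2) (N : ℕ) :
    sumMultiplicityLowDegree ℓ N ≤ q ^ (N + 1) * (x + 2 * x ^ 2) := by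
  classical
  have hq0 : 0 < q := by rw [hq]; positivity
  have hx0 : 0 ≤ x := by rw [hx]; positivity
  have hB : ∀ P ∈ (lowDegree k (N + 1)).erase 0, P.natDegree ≤ N := fun P hP =>
    natDegree_le_of_degree_le (Order.le_of_lt_succ
      (by exact_mod_cast mem_lowDegree.1 (Finset.mem_of_mem_erase hP)))
  have h1 : sumMultiplicityLowDegree ℓ N = ∑ j ∈ Finset.Icc 1 N,
      ((((lowDegree k (N + 1)).erase 0).filter fun P => ℓ ^ j ∣ P).card : ℝ) := by
    have := sum_multiplicity_eq_sum_card hirr ((lowDegree k (N + 1)).erase 0) id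
      (fun P hP => Finset.ne_of_mem_erase hP) hB
    rw [sumMultiplicityLowDegree]
    exact_mod_cast this
  have h2 : ∀ j, ((((lowDegree k (N + 1)).erase 0).filter fun P => ℓ ^ j ∣ P).card : ℝ) ≤
      q ^ (N + 1) * x ^ j := by
    intro j
    have h := card_filter_dvd_sub_le (hℓ.pow j) (N + 1) 0
    have h0 : (0 : k[X]) ∈ (lowDegree k (N + 1)).filter fun P => ℓ ^ j ∣ P - 0 := by
      simp [bot_lt_iff_ne_bot]
    rw [← Finset.card_erase_add_one h0, Nat.cast_add, Nat.cast_one, add_le_add_iff_right,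
      natDegree_pow, ← hq] at h
    rw [hx, one_div, inv_pow, ← div_eq_mul_inv, ← pow_mul, mul_comm ℓ.natDegree]
    refine le_trans (Nat.cast_le.2 (Finset.card_le_card fun P hP => ?_)) h
    simp only [Finset.mem_filter, Finset.mem_erase, sub_zero] at hP ⊢
    exact ⟨hP.1.1, hP.1.2, hP.2⟩
  have hsub : Finset.Icc 1 N ⊆ insert 1 (Finset.Icc 2 N) := by
    intro j hj
    rw [Finset.mem_Icc] at hj
    rw [Finset.mem_insert, Finset.mem_Icc]
    omega
  rw [h1]
  refine (Finset.sum_le_sum fun j _ => h2 j).trans ?_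
  rw [← Finset.mul_sum]
  gcongr
  refine (Finset.sum_le_sum_of_subset_of_nonneg hsub fun _ _ _ => by positivity).trans ?_
  rw [Finset.sum_insert (by simp), pow_one]
  gcongr
  exact sum_Icc_two_pow_le hx0 hx2 N

lemma abs_sub_le_of_tendsto_sumMultiplicityLowDegree {ℓ : k[X]} (hℓ : ℓ.Monic)
    (hirr : Irreducible ℓ) {q x A : ℝ} (hq : q = Fintype.card k)
    (hx : x = 1 / q ^ ℓ.natDegree) (hx2 : x ≤ 1 / 2)
    (hA : Tendsto (fun N => sumMultiplicityLowDegree ℓ N / (q ^ (N + 1) - 1)) atTop (nhds A)) :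
    |A - x| ≤ 2 * x ^ 2 := by
  have hq1 : 1 < q := by rw [hq]; exact one_lt_card_real
  have ht := tendsto_inv_card_pow_succ (k := k)
  rw [← hq] at ht
  have hlim : Tendsto (fun N => sumMultiplicityLowDegree ℓ N / q ^ (N + 1)) atTop (nhds A) := by
    have h := hA.mul (ht.const_sub 1)
    rw [sub_zero, mul_one] at h
    refine h.congr fun N => ?_
    have hy : 1 < q ^ (N + 1) := one_lt_pow₀ hq1 N.succ_ne_zero
    generalize q ^ (N + 1) = y at *
    have : y - 1 ≠ 0 := by linarith
    field_simp
  have hlow : x ≤ A := by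
    have h := ht.const_sub x
    rw [sub_zero] at h
    refine le_of_tendsto_of_tendsto h hlim ?_
    filter_upwards [eventually_ge_atTop (ℓ.natDegree)] with N hN
    have h1 := le_sumMultiplicityLowDegree hℓ hirr (hN.trans (Nat.le_succ N))
    rw [← hq, ← hx] at h1
    have hy : 0 < q ^ (N + 1) := by positivity
    rw [le_div_iff₀ hy, sub_mul, inv_mul_cancel₀ hy.ne']
    linarith
  have hup : A ≤ x + 2 * x ^ 2 := by
    refine le_of_tendsto hlim (Eventually.of_forall fun N => ?_)
    rw [div_le_iff₀ (by positivity), mul_comm]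
    exact sumMultiplicityLowDegree_le hℓ hirr hq hx hx2 N
  rw [abs_le]
  constructor
  · nlinarith [sq_nonneg x]
  · linarith

end LocalAverages

lemma summable_pow_half {x : ℝ} (hx0 : 0 ≤ x) (hx1 : x < 1) :
    Summable fun d : ℕ => x ^ (d / 2) := by
  have h := (summable_geometric_of_lt_one hx0 hx1).hasSum
  have he : ∀ n : ℕ, 2 * n / 2 = n := fun n => by omega
  have ho : ∀ n : ℕ, (2 * n + 1) / 2 = n := fun n => by omega
  exact (HasSum.even_add_odd (by simpa only [he] using h) (by simpa only [ho] using h)).summable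

lemma exists_tendsto_of_abs_le {s : ℕ → ℝ} {x C c : ℝ} {d₀ : ℕ} (hx0 : 0 ≤ x) (hx1 : x < 1)
    (h : ∀ d, d₀ ≤ d → |s d| ≤ C * x ^ (d / 2) + c * (d * x ^ d)) :
    ∃ L : ℝ, Tendsto (fun b : ℕ => ∑ d ∈ Finset.range (b + 1), s d) atTop (nhds L) := by
  have h1 : Summable fun d : ℕ => C * x ^ (d / 2) + c * (d * x ^ d) := by
    refine ((summable_pow_half hx0 hx1).mul_left C).add (Summable.mul_left c ?_)
    simpa using summable_pow_mul_geometric_of_norm_lt_one 1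
      (r := x) (by rwa [Real.norm_of_nonneg hx0])
  have h2 : Summable s := by
    refine Summable.of_norm_bounded_eventually_nat h1 ?_
    filter_upwards [eventually_ge_atTop d₀] with d hd
    exact h d hd
  exact ⟨_, (tendsto_add_atTop_iff_nat 1).2 h2.hasSum.tendsto_sum_nat⟩

section LocalInvariants

variable {k : Type*} [Field k]

lemma degree_lt_succ_iff_le {P : k[X]} {N : ℕ} : P.degree < (N + 1 : ℕ) ↔ P.degree ≤ N := by
  rcases eq_or_ne P 0 with rfl | h
  · simp [bot_lt_iff_ne_bot]
  · rw [degree_eq_natDegree h]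
    norm_cast
    omega

lemma exists_mul_add_mul_derivative_eq_C {f : k[X][X]}
    (hsep : (f.map (algebraMap k[X] (RatFunc k))).Separable) :
    ∃ (u v : k[X][X]) (D : k[X]), D ≠ 0 ∧ u * f + v * derivative f = C D := by
  rw [Separable, derivative_map] at hsep
  exact exists_mul_add_mul_eq_C hsep

lemma derivative_ne_zero_of_separable_map {f : k[X][X]} (hf : 1 ≤ f.natDegree)
    (hsep : (f.map (algebraMap k[X] (RatFunc k))).Separable) : derivative f ≠ 0 := by
  intro h
  rw [Separable, derivative_map, h, Polynomial.map_zero, isCoprime_zero_right] at hsep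
  have h1 := natDegree_eq_zero_of_isUnit hsep
  rw [natDegree_map_eq_of_injective (IsFractionRing.injective k[X] (RatFunc k))] at h1
  omega

variable [Fintype k]

open scoped Classical in
lemma coe_erase_lowDegree_succ (N : ℕ) :
    (((lowDegree k (N + 1)).erase 0 : Finset k[X]) : Set k[X]) =
      {P : k[X] | P ≠ 0 ∧ P.degree ≤ (N : WithBot ℕ)} := by
  ext P
  simp only [Finset.coe_erase, Set.mem_sdiff, Finset.mem_coe, mem_lowDegree,
    degree_lt_succ_iff_le, Set.mem_singleton_iff, Set.mem_ofPred_eq]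
  tauto

lemma coe_coprimePairs_homogEvalNeZero (f : k[X][X]) (N : ℕ) :
    (coprimePairs (HomogEvalNeZero f) N : Set (k[X] × k[X])) =
      {ab : k[X] × k[X] | IsCoprime ab.1 ab.2 ∧ homogEval f ab.1 ab.2 ≠ 0 ∧
        ab.1.degree ≤ (N : WithBot ℕ) ∧ ab.2.degree ≤ (N : WithBot ℕ)} := by
  ext P
  simp only [Finset.mem_coe, mem_coprimePairs, degree_lt_succ_iff_le, HomogEvalNeZero,
    Set.mem_ofPred_eq]
  tauto

lemma abs_local_sub_le {f u v : k[X][X]} {D ℓ : k[X]} (hf : 1 ≤ f.natDegree)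
    (hℓ : ℓ.Monic) (hirr : Irreducible ℓ) (hlc : ¬ ℓ ∣ f.leadingCoeff)
    (huv : u * f + v * derivative f = C D) (hD : ¬ ℓ ∣ D) {A₁ A₂ : ℝ}
    (hA₁ : Tendsto (fun N : ℕ =>
      (∑ᶠ P ∈ {P : k[X] | P ≠ 0 ∧ P.degree ≤ (N : WithBot ℕ)}, (multiplicity ℓ P : ℝ)) /
        (({P : k[X] | P ≠ 0 ∧ P.degree ≤ (N : WithBot ℕ)}).ncard : ℝ)) atTop (nhds A₁))
    (hA₂ : Tendsto (fun N : ℕ =>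
      (∑ᶠ ab ∈ {ab : k[X] × k[X] | IsCoprime ab.1 ab.2 ∧ homogEval f ab.1 ab.2 ≠ 0 ∧
          ab.1.degree ≤ (N : WithBot ℕ) ∧ ab.2.degree ≤ (N : WithBot ℕ)},
        (multiplicity ℓ (homogEval f ab.1 ab.2) : ℝ)) /
        (({ab : k[X] × k[X] | IsCoprime ab.1 ab.2 ∧ homogEval f ab.1 ab.2 ≠ 0 ∧
          ab.1.degree ≤ (N : WithBot ℕ) ∧ ab.2.degree ≤ (N : WithBot ℕ)}).ncard : ℝ))
      atTop (nhds A₂)) :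
    |A₁ - A₂ - (1 - (residueRoots f ℓ).card) * (1 / (Fintype.card k : ℝ) ^ ℓ.natDegree)| ≤
      (4 + 5 * f.natDegree) * (1 / (Fintype.card k : ℝ) ^ ℓ.natDegree) ^ 2 := by
  classical
  have hx2 : 1 / (Fintype.card k : ℝ) ^ ℓ.natDegree ≤ 1 / 2 := by
    refine one_div_le_one_div_of_le two_pos ?_
    have h2 : (2 : ℝ) ≤ Fintype.card k := by exact_mod_cast Fintype.one_lt_card
    exact h2.trans (le_self_pow₀ one_lt_card_real.le hirr.natDegree_pos.ne')
  have h1 := abs_sub_le_of_tendsto_sumMultiplicityLowDegree hℓ hirr rfl rfl hx2 (A := A₁) (by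
    refine hA₁.congr fun N => ?_
    rw [← coe_erase_lowDegree_succ, finsum_mem_coe_finset, Set.ncard_coe_finset,
      sumMultiplicityLowDegree]
    congr 1
    have h := Finset.card_erase_add_one (s := lowDegree k (N + 1)) (a := 0)
      (by simp [bot_lt_iff_ne_bot])
    rw [card_lowDegree] at h
    rw [eq_sub_iff_add_eq]
    exact_mod_cast h)
  have h2 := abs_sub_le_of_tendsto_sumMultiplicity hf hℓ hirr hlc huv hD rfl rfl hx2 (A := A₂) (by
    refine hA₂.congr fun N => ?_
    rw [← coe_coprimePairs_homogEvalNeZero, finsum_mem_coe_finset, Set.ncard_coe_finset,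
      sumMultiplicity])
  rw [abs_le] at h1 h2 ⊢
  constructor
  · linarith
  · linarith

lemma finsum_monic_irreducible_eq (g : k[X] → ℝ) (b : ℕ) :
    ∑ᶠ ℓ ∈ {ℓ : k[X] | ℓ.Monic ∧ Irreducible ℓ ∧ ℓ.degree ≤ (b : WithBot ℕ)}, g ℓ =
      ∑ d ∈ Finset.range (b + 1), ∑ ℓ ∈ monicIrreducibles k d, g ℓ := by
  classical
  have h : {ℓ : k[X] | ℓ.Monic ∧ Irreducible ℓ ∧ ℓ.degree ≤ (b : WithBot ℕ)} =
      (((Finset.range (b + 1)).biUnion (monicIrreducibles k) : Finset k[X]) : Set k[X]) := by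
    ext ℓ
    simp only [Set.mem_ofPred_eq, Finset.coe_biUnion, Set.mem_iUnion, Finset.mem_coe,
      Finset.mem_range, mem_monicIrreducibles, exists_prop, ← natDegree_le_iff_degree_le]
    constructor
    · rintro ⟨h1, h2, h3⟩
      exact ⟨_, Nat.lt_succ_of_le h3, h1, h2, rfl⟩
    · rintro ⟨d, hd, h1, h2, rfl⟩
      exact ⟨h1, h2, Nat.lt_succ_iff.1 hd⟩
  rw [h, finsum_mem_coe_finset, Finset.sum_biUnion]
  intro d _ d' _ hne
  refine Finset.disjoint_left.2 fun ℓ hℓ hℓ' => hne ?_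
  rw [← (mem_monicIrreducibles.1 hℓ).2.2, (mem_monicIrreducibles.1 hℓ').2.2]

lemma exists_abs_sum_local_le {F : Type*} [Field F] [Algebra k F] [IsAlgClosed F]
    [Algebra.IsAlgebraic k F] {f : k[X][X]} {D : k[X]} (hf : 1 ≤ f.natDegree)
    (hder : derivative f ≠ 0)
    (habs : Irreducible (f.map (mapRingHom (algebraMap k F)))) (hD : D ≠ 0)
    {g : k[X] → ℝ} {c : ℝ} (hc : 0 ≤ c)
    (hg : ∀ ℓ : k[X], ℓ.Monic → Irreducible ℓ → ¬ ℓ ∣ f.leadingCoeff → ¬ ℓ ∣ D →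
      |g ℓ - ℓ.natDegree * ((1 - (residueRoots f ℓ).card) *
        (1 / (Fintype.card k : ℝ) ^ ℓ.natDegree))| ≤
      ℓ.natDegree * (c * (1 / (Fintype.card k : ℝ) ^ ℓ.natDegree) ^ 2)) :
    ∃ (C : ℝ) (d₀ : ℕ), ∀ d, d₀ ≤ d → |∑ ℓ ∈ monicIrreducibles k d, g ℓ| ≤
      C * ((1 / (Fintype.card k : ℝ)) ^ (d / 2)) + c * (d * (1 / (Fintype.card k : ℝ)) ^ d) := by
  obtain ⟨C, d₀, hC⟩ := exists_abs_sum_residueRoots_le hf hder habs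
  have hq := one_lt_card_real (k := k)
  refine ⟨C, max d₀ (max (f.leadingCoeff.natDegree + 1) (D.natDegree + 1)), fun d hd => ?_⟩
  simp only [max_le_iff] at hd
  have hf0 : f.leadingCoeff ≠ 0 := by
    rw [leadingCoeff_ne_zero]; rintro rfl; simp at hf
  have hC' := hC d hd.1
  have h1 : |∑ ℓ ∈ monicIrreducibles k d, (d : ℝ) * (1 - (residueRoots f ℓ).card)| ≤
      C * (Fintype.card k : ℝ) ^ (d - d / 2) := by exact_mod_cast hC'
  have h2 : ∀ ℓ ∈ monicIrreducibles k d, |g ℓ - (d : ℝ) * (1 - (residueRoots f ℓ).card) *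
      (1 / (Fintype.card k : ℝ) ^ d)| ≤ d * (c * (1 / (Fintype.card k : ℝ) ^ d) ^ 2) := by
    intro ℓ hℓ
    obtain ⟨hm, hirr, rfl⟩ := mem_monicIrreducibles.1 hℓ
    rw [mul_assoc]
    exact hg ℓ hm hirr (hm.not_dvd_of_natDegree_lt hf0 hd.2.1)
      (hm.not_dvd_of_natDegree_lt hD hd.2.2)
  have h3 : |∑ ℓ ∈ monicIrreducibles k d, g ℓ - (∑ ℓ ∈ monicIrreducibles k d,
      (d : ℝ) * (1 - (residueRoots f ℓ).card)) * (1 / (Fintype.card k : ℝ) ^ d)| ≤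
      (Fintype.card k : ℝ) ^ d * (d * (c * (1 / (Fintype.card k : ℝ) ^ d) ^ 2)) := by
    rw [Finset.sum_mul, ← Finset.sum_sub_distrib]
    refine (Finset.abs_sum_le_sum_abs _ _).trans ((Finset.sum_le_card_nsmul _ _ _ h2).trans ?_)
    rw [nsmul_eq_mul]
    gcongr
    exact_mod_cast card_monicIrreducibles_le d
  set s := ∑ ℓ ∈ monicIrreducibles k d, g ℓ
  set T := ∑ ℓ ∈ monicIrreducibles k d, (d : ℝ) * (1 - (residueRoots f ℓ).card)
  generalize (Fintype.card k : ℝ) = q at *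
  have hq0 : q ≠ 0 := by positivity
  have e1 : q ^ d * (d * (c * (1 / q ^ d) ^ 2)) = c * (d * (1 / q) ^ d) := by
    rw [one_div_pow q d]; field_simp
  have e2 : |T * (1 / q ^ d)| ≤ C * (1 / q) ^ (d / 2) := by
    rw [abs_mul, abs_of_nonneg (a := 1 / q ^ d) (by positivity)]
    have e3 : (C : ℝ) * (1 / q) ^ (d / 2) = C * q ^ (d - d / 2) * (1 / q ^ d) := by
      rw [pow_sub₀ q hq0 (Nat.div_le_self d 2), one_div_pow]; field_simp
    rw [e3]
    gcongr
  rw [e1] at h3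
  calc |s| = |(s - T * (1 / q ^ d)) + T * (1 / q ^ d)| := by rw [sub_add_cancel]
    _ ≤ _ := (abs_add_le _ _).trans (by linarith)

end LocalInvariants

/-- (Theorem `alpha_convergence`.)  Let `f ∈ F_q[t][x]` with
`deg_x f ≥ 1`, separable in `x` over `F_q(t)` and absolutely irreducible (irreducible as a
bivariate polynomial over an algebraic closure of `F_q`).  Assume given local values
`αl ℓ = deg ℓ · (A₁(ℓ) - A₂(ℓ))` for every monic irreducible `ℓ` (they exist for all but
finitely many `ℓ`; for the remaining ones existence is assumed).  Then the limit
`α(f) = lim_{b₀ → ∞} Σ_{deg ℓ ≤ b₀} αl ℓ` exists. -/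
theorem alpha_convergence
    (Fq : Type*) [Field Fq] [Fintype Fq]
    (f : Polynomial (Polynomial Fq)) (hd1 : 1 ≤ f.natDegree)
    (hsep : (f.map (algebraMap (Polynomial Fq) (RatFunc Fq))).Separable)
    (habs : Irreducible (f.map
      (Polynomial.mapRingHom (algebraMap Fq (AlgebraicClosure Fq)))))
    (αl : Polynomial Fq → ℝ)
    (hαl : ∀ ℓ : Polynomial Fq, ℓ.Monic → Irreducible ℓ →
      ∃ A₁ A₂ : ℝ,
        Filter.Tendsto (fun N : ℕ =>
            (∑ᶠ P ∈ {P : Polynomial Fq | P ≠ 0 ∧ P.degree ≤ (N : WithBot ℕ)},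
              (multiplicity ℓ P : ℝ)) /
            (({P : Polynomial Fq | P ≠ 0 ∧ P.degree ≤ (N : WithBot ℕ)}).ncard : ℝ))
          Filter.atTop (nhds A₁) ∧
        Filter.Tendsto (fun N : ℕ =>
            (∑ᶠ ab ∈ {ab : Polynomial Fq × Polynomial Fq | IsCoprime ab.1 ab.2 ∧
                homogEval f ab.1 ab.2 ≠ 0 ∧
                ab.1.degree ≤ (N : WithBot ℕ) ∧ ab.2.degree ≤ (N : WithBot ℕ)},
              (multiplicity ℓ (homogEval f ab.1 ab.2) : ℝ)) /
            (({ab : Polynomial Fq × Polynomial Fq | IsCoprime ab.1 ab.2 ∧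
                homogEval f ab.1 ab.2 ≠ 0 ∧
                ab.1.degree ≤ (N : WithBot ℕ) ∧ ab.2.degree ≤ (N : WithBot ℕ)}).ncard : ℝ))
          Filter.atTop (nhds A₂) ∧
        αl ℓ = (ℓ.natDegree : ℝ) * (A₁ - A₂)) :
    ∃ L : ℝ,
      Filter.Tendsto (fun b₀ : ℕ =>
          ∑ᶠ ℓ ∈ {ℓ : Polynomial Fq | ℓ.Monic ∧ Irreducible ℓ ∧ ℓ.degree ≤ (b₀ : WithBot ℕ)},
            αl ℓ)
        Filter.atTop (nhds L) := by
  obtain ⟨u, v, D, hD, huv⟩ := exists_mul_add_mul_derivative_eq_C hsep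
  have hq := one_lt_card_real (k := Fq)
  obtain ⟨C, d₀, h⟩ := exists_abs_sum_local_le hd1 (derivative_ne_zero_of_separable_map hd1 hsep)
    habs hD (g := αl) (c := 4 + 5 * f.natDegree) (by positivity) (by
      intro ℓ hℓ hirr hlc hℓD
      obtain ⟨A₁, A₂, h₁, h₂, hα⟩ := hαl ℓ hℓ hirr
      rw [hα, ← mul_sub, abs_mul, Nat.abs_cast]
      exact mul_le_mul_of_nonneg_left (abs_local_sub_le hd1 hℓ hirr hlc huv hℓD h₁ h₂)
        (Nat.cast_nonneg _))
  simp only [finsum_monic_irreducible_eq]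
  exact exists_tendsto_of_abs_le (by positivity) (by rw [div_lt_one] <;> linarith) h
end

section
/- Let q be a prime power, s ∈ ℤ, and let r ∈ F_q[t, t^{−1}] be a nonzero Laurent polynomial of degree deg r whose lowest-order term has order ≥ −m for an integer m ≥ −deg r; set N_r = deg r + m. For integers A, B ≥ 0 with A − B = s, let D(A,B) = {(a,b) ∈ F_q[t]² : deg a ≤ A, deg b ≤ B} and let M(A,B) = {(a,b) ∈ D(A,B) : b ≠ 0 and v(a/b − r) ≥ m+1}, where v is the 1/t-adic valuation on F_q((1/t)) (with v(0) = +∞). Then, as A, B → ∞ with A − B = s fixed, #M(A,B)/#D(A,B) → q^{−N_r − |s − deg r|}/(q + 1). -/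
open Polynomial Filter

section Counting

variable {F : Type*} [Field F]

theorem ncard_setOf_degree_lt [Fintype F] (n : ℕ) :
    {f : F[X] | f.degree < n}.ncard = Fintype.card F ^ n := by
  have h : {f : F[X] | f.degree < n} = (degreeLT F n : Set F[X]) := by
    ext f
    simp [mem_degreeLT]
  rw [h, ← Nat.card_coe_set_eq]
  refine (Nat.card_congr (degreeLTEquiv F n).toEquiv).trans ?_
  simp

theorem finite_setOf_degree_lt_s12 [Fintype F] (n : ℕ) : {f : F[X] | f.degree < n}.Finite :=
  Set.finite_of_ncard_ne_zero <| by
    rw [ncard_setOf_degree_lt]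
    exact pow_ne_zero _ Fintype.card_ne_zero

theorem ncard_setOf_natDegree_eq [Fintype F] (n : ℕ) :
    {f : F[X] | f ≠ 0 ∧ f.natDegree = n}.ncard = Fintype.card F ^ (n + 1) - Fintype.card F ^ n := by
  have h : {f : F[X] | f ≠ 0 ∧ f.natDegree = n} =
      {f : F[X] | f.degree < (n + 1 : ℕ)} \ {f : F[X] | f.degree < n} := by
    ext f
    by_cases hf : f = 0
    · simp [hf]
    · simp only [Set.mem_ofPred_eq, Set.mem_sdiff, ← natDegree_lt_iff_degree_lt hf]
      simp only [ne_eq, hf, not_false_eq_true, true_and]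
      omega
  rw [h, Set.ncard_sdiff ?_ (finite_setOf_degree_lt_s12 n), ncard_setOf_degree_lt,
    ncard_setOf_degree_lt]
  intro f hf
  exact lt_of_lt_of_le (b := (n : WithBot ℕ)) hf (by exact_mod_cast n.le_succ)

/-- For `b ≠ 0` and `Q ≠ 0`, the condition `deg (a / b - P / Q) ≤ -(m + 1)`, cleared of denominators. -/
def QuotientClose (P Q : F[X]) (m : ℤ) (a b : F[X]) : Prop :=
  a * Q - b * P = 0 ∨ ((a * Q - b * P).natDegree : ℤ) + m + 1 ≤ b.natDegree + Q.natDegree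

/-- The pairs `(a, b)` with `b ≠ 0` of degree at most `K` and `a / b` close to `P / Q`. -/
def closePairs (P Q : F[X]) (m : ℤ) (K : ℕ) : Set (F[X] × F[X]) :=
  {ab | ab.2 ≠ 0 ∧ ab.2.natDegree ≤ K ∧ QuotientClose P Q m ab.1 ab.2}

theorem quotientClose_iff (P : F[X]) {Q : F[X]} (hQ : Q ≠ 0) (m : ℤ) (a : F[X]) {b : F[X]}
    (hb : b ≠ 0) :
    (algebraMap F[X] (RatFunc F) a / algebraMap F[X] (RatFunc F) b -
          algebraMap F[X] (RatFunc F) P / algebraMap F[X] (RatFunc F) Q = 0 ∨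
        (algebraMap F[X] (RatFunc F) a / algebraMap F[X] (RatFunc F) b -
          algebraMap F[X] (RatFunc F) P / algebraMap F[X] (RatFunc F) Q).intDegree ≤ -(m + 1)) ↔
      QuotientClose P Q m a b := by
  have hb' := RatFunc.algebraMap_ne_zero hb
  have hQ' := RatFunc.algebraMap_ne_zero hQ
  have key : algebraMap F[X] (RatFunc F) a / algebraMap F[X] (RatFunc F) b -
      algebraMap F[X] (RatFunc F) P / algebraMap F[X] (RatFunc F) Q =
      algebraMap F[X] (RatFunc F) (a * Q - b * P) / algebraMap F[X] (RatFunc F) (b * Q) := by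
    rw [div_sub_div _ _ hb' hQ']
    simp
  rw [key, QuotientClose]
  by_cases hy : a * Q - b * P = 0
  · simp [hy]
  · have hbQ := mul_ne_zero hb hQ
    have hy' := RatFunc.algebraMap_ne_zero hy
    have hbQ' := RatFunc.algebraMap_ne_zero hbQ
    rw [RatFunc.intDegree_div hy' hbQ', RatFunc.intDegree_polynomial, RatFunc.intDegree_polynomial,
      natDegree_mul hb hQ]
    simp only [div_eq_zero_iff, hy', hbQ', hy, or_self, false_or]
    push_cast
    constructor <;> intro h <;> linarith

theorem QuotientClose.natDegree_add_natDegree {P Q : F[X]} (hP : P ≠ 0) (hQ : Q ≠ 0) {m : ℤ}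
    (hm : (Q.natDegree : ℤ) ≤ P.natDegree + m) {a b : F[X]} (hb : b ≠ 0)
    (h : QuotientClose P Q m a b) :
    a.natDegree + Q.natDegree = b.natDegree + P.natDegree := by
  have hbP : (b * P).natDegree = b.natDegree + P.natDegree := natDegree_mul hb hP
  have hmul : (a * Q).natDegree = (b * P).natDegree := by
    rcases h with h | h
    · rw [sub_eq_zero.mp h]
    · have hlt : (a * Q - b * P).natDegree < (b * P).natDegree := by omega
      rw [← natDegree_add_eq_right_of_natDegree_lt hlt, sub_add_cancel]
  have ha : a ≠ 0 := by
    rintro rfl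
    rcases h with h | h
    · simp [hb, hP] at h
    · rw [zero_mul, zero_sub, natDegree_neg, hbP] at h
      push_cast at h
      linarith
  rw [← hbP, ← hmul, natDegree_mul ha hQ]

theorem quotientClose_iff_degree_sub_lt {P Q : F[X]} (hQ : Q.Monic) {m : ℤ} {j : ℕ} (a : F[X])
    {b : F[X]} (hj : (b.natDegree : ℤ) = m + j) :
    QuotientClose P Q m a b ↔ (a - b * P /ₘ Q).degree < j := by
  have hsub : a * Q - b * P = (a - b * P /ₘ Q) * Q - b * P %ₘ Q := by
    linear_combination modByMonic_add_div (b * P) Q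
  have hdeg : QuotientClose P Q m a b ↔ (a * Q - b * P).degree < (j + Q.natDegree : ℕ) := by
    rw [QuotientClose]
    by_cases hy : a * Q - b * P = 0
    · simp [hy]
    · rw [← natDegree_lt_iff_degree_lt hy]
      simp only [hy, false_or]
      omega
  have hρ : b * P %ₘ Q ∈ degreeLT F (j + Q.natDegree) := by
    rw [mem_degreeLT]
    refine (degree_modByMonic_lt _ hQ).trans_le ?_
    rw [degree_eq_natDegree hQ.ne_zero]
    exact_mod_cast Nat.le_add_left _ _
  rw [hdeg, hsub, ← mem_degreeLT, Submodule.sub_mem_iff_left _ hρ, mem_degreeLT]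
  by_cases he : a - b * P /ₘ Q = 0
  · simp [he]
  · rw [← natDegree_lt_iff_degree_lt he, ← natDegree_lt_iff_degree_lt (mul_ne_zero he hQ.ne_zero),
      natDegree_mul he hQ.ne_zero]
    omega

theorem ncard_quotientClose_natDegree_eq [Fintype F] (P : F[X]) {Q : F[X]} (hQ : Q.Monic) {m : ℤ}
    {k j : ℕ} (hj : (k : ℤ) = m + j) :
    {ab : F[X] × F[X] | ab.2 ≠ 0 ∧ ab.2.natDegree = k ∧ QuotientClose P Q m ab.1 ab.2}.ncard =
      Fintype.card F ^ j * (Fintype.card F ^ (k + 1) - Fintype.card F ^ k) := by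
  let f : F[X] × F[X] → F[X] × F[X] := fun eb ↦ (eb.1 + eb.2 * P /ₘ Q, eb.2)
  have hf : Function.Injective f := by
    rintro ⟨e, b⟩ ⟨e', b'⟩ h
    simp only [f, Prod.mk.injEq] at h
    obtain ⟨h, rfl⟩ := h
    simpa using h
  have himage : {ab : F[X] × F[X] | ab.2 ≠ 0 ∧ ab.2.natDegree = k ∧
      QuotientClose P Q m ab.1 ab.2} =
      f '' ({e : F[X] | e.degree < j} ×ˢ {b : F[X] | b ≠ 0 ∧ b.natDegree = k}) := by
    ext ⟨a, b⟩
    constructor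
    · rintro ⟨hb, hk, h⟩
      rw [quotientClose_iff_degree_sub_lt hQ a (j := j) (by simpa [hk] using hj)] at h
      exact ⟨(a - b * P /ₘ Q, b), ⟨h, hb, hk⟩, by simp [f]⟩
    · rintro ⟨⟨e, b'⟩, ⟨he, hb, hk⟩, h⟩
      simp only [f, Prod.mk.injEq] at h he hb hk
      obtain ⟨rfl, rfl⟩ := h
      refine ⟨hb, hk, ?_⟩
      rw [quotientClose_iff_degree_sub_lt hQ _ (j := j) (by simpa [hk] using hj)]
      simpa using he
  rw [himage, Set.ncard_image_of_injective _ hf, Set.ncard_prod, ncard_setOf_degree_lt,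
    ncard_setOf_natDegree_eq]

theorem finite_closePairs [Fintype F] {P Q : F[X]} (hP : P ≠ 0) (hQ : Q ≠ 0) {m : ℤ}
    (hm : (Q.natDegree : ℤ) ≤ P.natDegree + m) (K : ℕ) : (closePairs P Q m K).Finite := by
  refine ((finite_setOf_degree_lt_s12 (K + P.natDegree + 1)).prod
    (finite_setOf_degree_lt_s12 (K + 1))).subset ?_
  rintro ⟨a, b⟩ ⟨hb, hK, h⟩
  have hadd := h.natDegree_add_natDegree hP hQ hm hb
  simp only at hK hadd
  refine ⟨degree_le_natDegree.trans_lt ?_, degree_le_natDegree.trans_lt ?_⟩ <;>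
  · norm_cast
    dsimp only
    omega

theorem ncard_closePairs_succ [Fintype F] {P Q : F[X]} (hP : P ≠ 0) (hQ : Q.Monic) {m : ℤ}
    (hm : (Q.natDegree : ℤ) ≤ P.natDegree + m) {K j : ℕ} (hj : (K : ℤ) + 1 = m + j) :
    (closePairs P Q m (K + 1)).ncard = (closePairs P Q m K).ncard +
      Fintype.card F ^ j * (Fintype.card F ^ (K + 2) - Fintype.card F ^ (K + 1)) := by
  have hunion : closePairs P Q m (K + 1) = closePairs P Q m K ∪
      {ab | ab.2 ≠ 0 ∧ ab.2.natDegree = K + 1 ∧ QuotientClose P Q m ab.1 ab.2} := by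
    ext ab
    simp only [closePairs, Set.mem_union, Set.mem_ofPred_eq, Nat.le_succ_iff]
    tauto
  have hfin := finite_closePairs hP hQ.ne_zero hm (K + 1)
  rw [hunion] at hfin ⊢
  rw [Set.ncard_union_eq ?_ (hfin.subset Set.subset_union_left)
    (hfin.subset Set.subset_union_right),
    ncard_quotientClose_natDegree_eq P hQ (j := j) (by exact_mod_cast hj)]
  rw [Set.disjoint_left]
  rintro ab ⟨_, hle, _⟩ ⟨_, heq, _⟩
  omega

theorem exists_ncard_closePairs_eq [Fintype F] {P Q : F[X]} (hP : P ≠ 0) (hQ : Q.Monic) {m : ℤ}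
    (hm : (Q.natDegree : ℤ) ≤ P.natDegree + m) :
    ∃ c : ℝ, ∀ K : ℕ, m ≤ K → ((Fintype.card F : ℝ) + 1) * (closePairs P Q m K).ncard =
      (Fintype.card F : ℝ) ^ (2 * (K : ℤ) + 2 - m) + c := by
  have hq : (Fintype.card F : ℝ) ≠ 0 := by simp
  refine ⟨((Fintype.card F : ℝ) + 1) * (closePairs P Q m m.toNat).ncard -
    (Fintype.card F : ℝ) ^ (2 * (m.toNat : ℤ) + 2 - m), fun K hK ↦ ?_⟩
  have hK' : m.toNat ≤ K := by omega
  clear hK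
  induction K, hK' using Nat.le_induction with
  | base => ring
  | succ K hK ih =>
    obtain ⟨j, hj⟩ : ∃ j : ℕ, (K : ℤ) + 1 = m + j := ⟨(K + 1 - m).toNat, by omega⟩
    have hle : Fintype.card F ^ (K + 1) ≤ Fintype.card F ^ (K + 2) :=
      Nat.pow_le_pow_right Fintype.card_pos (by omega)
    rw [ncard_closePairs_succ hP hQ hm hj]
    push_cast [Nat.cast_sub hle]
    rw [mul_add, ih]
    have h1 : 2 * (K : ℤ) + 2 - m = (j + (K + 1) : ℕ) := by push_cast; linarith
    have h2 : 2 * ((K : ℤ) + 1) + 2 - m = (j + (K + 3) : ℕ) := by push_cast; linarith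
    rw [h1, h2, zpow_natCast, zpow_natCast]
    ring

theorem setOf_quotientClose_eq_closePairs {P Q : F[X]} (hP : P ≠ 0) (hQ : Q ≠ 0) {m : ℤ}
    (hm : (Q.natDegree : ℤ) ≤ P.natDegree + m) {A B K : ℕ}
    (hK : (K : ℤ) = min (B : ℤ) (A - (P.natDegree - Q.natDegree))) :
    {ab : F[X] × F[X] | ab.1.degree ≤ (A : WithBot ℕ) ∧ ab.2.degree ≤ (B : WithBot ℕ) ∧
      ab.2 ≠ 0 ∧
      (algebraMap F[X] (RatFunc F) ab.1 / algebraMap F[X] (RatFunc F) ab.2 -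
          algebraMap F[X] (RatFunc F) P / algebraMap F[X] (RatFunc F) Q = 0 ∨
        (algebraMap F[X] (RatFunc F) ab.1 / algebraMap F[X] (RatFunc F) ab.2 -
          algebraMap F[X] (RatFunc F) P / algebraMap F[X] (RatFunc F) Q).intDegree ≤ -(m + 1))} =
      closePairs P Q m K := by
  ext ⟨a, b⟩
  simp only [closePairs, Set.mem_ofPred_eq, ← natDegree_le_iff_degree_le]
  constructor
  · rintro ⟨hA, hB, hb, h⟩
    rw [quotientClose_iff _ hQ m a hb] at h
    have hadd := h.natDegree_add_natDegree hP hQ hm hb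
    exact ⟨hb, by omega, h⟩
  · rintro ⟨hb, hle, h⟩
    have hadd := h.natDegree_add_natDegree hP hQ hm hb
    exact ⟨by omega, by omega, hb, (quotientClose_iff _ hQ m a hb).mpr h⟩

theorem ncard_setOf_degree_le_and_degree_le [Fintype F] (A B : ℕ) :
    {ab : F[X] × F[X] | ab.1.degree ≤ (A : WithBot ℕ) ∧ ab.2.degree ≤ (B : WithBot ℕ)}.ncard =
      Fintype.card F ^ (A + B + 2) := by
  have h (n : ℕ) (f : F[X]) : f.degree ≤ (n : WithBot ℕ) ↔ f.degree < (n + 1 : ℕ) := by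
    by_cases hf : f = 0
    · simp [hf]
    · rw [← natDegree_le_iff_degree_le, ← natDegree_lt_iff_degree_lt hf, Nat.lt_succ_iff]
  have hprod : {ab : F[X] × F[X] | ab.1.degree ≤ (A : WithBot ℕ) ∧
      ab.2.degree ≤ (B : WithBot ℕ)} =
      {f : F[X] | f.degree < (A + 1 : ℕ)} ×ˢ {f : F[X] | f.degree < (B + 1 : ℕ)} := by
    ext ab
    simp only [h, Set.mem_ofPred_eq, Set.mem_prod]
  rw [hprod, Set.ncard_prod, ncard_setOf_degree_lt, ncard_setOf_degree_lt]
  ring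

end Counting

/-- Let `r` be a nonzero Laurent polynomial in `t` (a rational function
such that `t^m · r` is a polynomial) of degree `deg r = intDegree r`, with `m ≥ -deg r`, and
set `N_r = deg r + m`.  Among pairs `(a,b)` with `deg a ≤ A`, `deg b ≤ B`, `A - B = s`, the
proportion of pairs with `b ≠ 0` and `v(a/b - r) ≥ m + 1` (i.e. the expansion of `a/b`
agrees with `r` down to order `t^{-m}`; here `v` is the `1/t`-adic valuation, so the
condition reads `a/b - r = 0` or `deg(a/b - r) ≤ -(m+1)`) tends to
`q^{-N_r - |s - deg r|}/(q+1)` as `A, B → ∞` with `A - B = s`. -/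
theorem laurent_root_matching_density
    (Fq : Type*) [Field Fq] [Fintype Fq] (s : ℤ)
    (r : RatFunc Fq) (hr : r ≠ 0) (m : ℤ) (hm : -r.intDegree ≤ m)
    (hLaurent : ∃ p : Polynomial Fq,
      (algebraMap (Polynomial Fq) (RatFunc Fq)) p =
        r * ((algebraMap (Polynomial Fq) (RatFunc Fq)) Polynomial.X) ^ m) :
    ∀ A B : ℕ → ℕ, (∀ n, (A n : ℤ) - (B n : ℤ) = s) →
      Filter.Tendsto A Filter.atTop Filter.atTop →
      Filter.Tendsto (fun n : ℕ =>
        (({ab : Polynomial Fq × Polynomial Fq |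
            ab.1.degree ≤ ((A n : ℕ) : WithBot ℕ) ∧ ab.2.degree ≤ ((B n : ℕ) : WithBot ℕ) ∧
            ab.2 ≠ 0 ∧
            ((algebraMap (Polynomial Fq) (RatFunc Fq)) ab.1 /
                (algebraMap (Polynomial Fq) (RatFunc Fq)) ab.2 - r = 0 ∨
              ((algebraMap (Polynomial Fq) (RatFunc Fq)) ab.1 /
                  (algebraMap (Polynomial Fq) (RatFunc Fq)) ab.2 - r).intDegree ≤ -(m + 1))}).ncard : ℝ) /
        (({ab : Polynomial Fq × Polynomial Fq |
            ab.1.degree ≤ ((A n : ℕ) : WithBot ℕ) ∧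
            ab.2.degree ≤ ((B n : ℕ) : WithBot ℕ)}).ncard : ℝ))
        Filter.atTop
        (nhds ((Fintype.card Fq : ℝ) ^ (-(r.intDegree + m) - |s - r.intDegree|) /
          ((Fintype.card Fq : ℝ) + 1))) := by
  intro A B hAB hA
  have hq : (Fintype.card Fq : ℝ) ≠ 0 := by simp
  have hq1 : 1 < (Fintype.card Fq : ℝ) := by exact_mod_cast Fintype.one_lt_card
  have hP : r.num ≠ 0 := RatFunc.num_ne_zero hr
  have hQ : r.denom.Monic := r.monic_denom
  have hdeg : r.intDegree = r.num.natDegree - r.denom.natDegree := rfl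
  have hm' : (r.denom.natDegree : ℤ) ≤ r.num.natDegree + m := by omega
  obtain ⟨c, hc⟩ := exists_ncard_closePairs_eq hP hQ hm'
  have hlim : Tendsto (fun n ↦ (Fintype.card Fq : ℝ) ^ (-(r.intDegree + m) - |s - r.intDegree|) /
      ((Fintype.card Fq : ℝ) + 1) + c / ((Fintype.card Fq : ℝ) + 1) /
        (Fintype.card Fq : ℝ) ^ (A n + B n + 2)) atTop
      (nhds ((Fintype.card Fq : ℝ) ^ (-(r.intDegree + m) - |s - r.intDegree|) /
        ((Fintype.card Fq : ℝ) + 1))) := by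
    have hexp : Tendsto (fun n ↦ A n + B n + 2) atTop atTop :=
      tendsto_atTop_mono (fun n ↦ by omega) hA
    simpa using ((tendsto_pow_atTop_atTop_of_one_lt hq1).comp hexp).const_div_atTop
      (c / ((Fintype.card Fq : ℝ) + 1)) |>.const_add _
  refine hlim.congr' ?_
  filter_upwards [hA.eventually_ge_atTop
    (m.natAbs + r.intDegree.natAbs + s.natAbs)] with n hn
  have hs := hAB n
  obtain ⟨K, hK⟩ : ∃ K : ℕ, (K : ℤ) = min (B n : ℤ) (A n - r.intDegree) :=
    ⟨(min (B n : ℤ) (A n - r.intDegree)).toNat, by omega⟩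
  have hset := setOf_quotientClose_eq_closePairs hP hQ.ne_zero hm' (hdeg ▸ hK)
  rw [RatFunc.num_div_denom] at hset
  have hcard : ((closePairs r.num r.denom m K).ncard : ℝ) =
      ((Fintype.card Fq : ℝ) ^ (2 * (K : ℤ) + 2 - m) + c) / ((Fintype.card Fq : ℝ) + 1) := by
    rw [← hc K (by omega)]
    field_simp
  have hexp : 2 * (K : ℤ) + 2 - m =
      (-(r.intDegree + m) - |s - r.intDegree|) + (A n + B n + 2 : ℕ) := by
    push_cast
    rcases abs_cases (s - r.intDegree) with h | h <;> omega
  rw [hset, ncard_setOf_degree_le_and_degree_le, hcard, hexp, zpow_add₀ hq, zpow_natCast]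
  push_cast
  field_simp
end
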